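/- arXiv:0809.0117 — 3 statements merged into one kernel-verified Lean document; each statement's English description precedes it below -/
import Mathlib

section
/- Let G be a brane tiling with dual quiver Q, weight group Λ and weight function wt : ℤ^{Q_1} → Λ. Assume that either (1) the bipartite graph G is non-degenerate, or (2) all faces of Q contain the same number of arrows. Then for any (x_a)_{a∈Q_1} ∈ ℕ^{Q_1} ∖ {0}, the element Σ_{a∈Q_1} x_a·wt(a) is non-zero in Λ. Consequently the arrows of Q generate a strongly convex cone in Λ ⊗_ℤ ℝ. -/
open scoped Classical

noncomputable section

/-- A quiver, given by a vertex set, an arrow set, and source/target maps. -/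
structure Quiv where
  V : Type
  A : Type
  src : A → V
  tgt : A → V

namespace Quiv

/-- Strict paths in a quiver: `Path Q i j` is the type of (directed) paths from
`i` to `j`, built by prepending arrows. -/
inductive Path (Q : Quiv) : Q.V → Q.V → Type
  | nil (i : Q.V) : Path Q i i
  | cons {j : Q.V} (a : Q.A) (p : Path Q (Q.tgt a) j) : Path Q (Q.src a) j

namespace Path

variable {Q : Quiv}

/-- Composition of paths; `p.comp q` traverses `p` first and then `q`.
(In the algebraic right-to-left notation this is the product `q·p`.) -/
def comp : ∀ {i j k : Q.V}, Path Q i j → Path Q j k → Path Q i k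
  | _, _, _, .nil _, q => q
  | _, _, _, .cons a p, q => .cons a (p.comp q)

/-- The path consisting of a single arrow. -/
def single (a : Q.A) : Path Q (Q.src a) (Q.tgt a) := .cons a (.nil _)

/-- Transport a path along equalities of its endpoints. -/
def cast {i i' j j' : Q.V} (hi : i = i') (hj : j = j') (p : Path Q i j) :
    Path Q i' j' := by
  cases hi; cases hj; exact p

/-- The list of arrows traversed by a path (in order of traversal). -/
def arrows : ∀ {i j : Q.V}, Path Q i j → List Q.A
  | _, _, .nil _ => []
  | _, _, .cons a p => a :: p.arrows

/-- The content of a path: for each arrow, the multiplicity with which it occurs. -/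
def content : ∀ {i j : Q.V}, Path Q i j → (Q.A → ℤ)
  | _, _, .nil _ => 0
  | _, _, .cons a p => (fun b => if b = a then 1 else 0) + p.content

end Path

/-- Weak paths in a quiver: formal composites of arrows (`fwd`) and inverses of
arrows (`bwd`). -/
inductive WPath (Q : Quiv) : Q.V → Q.V → Type
  | nil (i : Q.V) : WPath Q i i
  | fwd {j : Q.V} (a : Q.A) (p : WPath Q (Q.tgt a) j) : WPath Q (Q.src a) j
  | bwd {j : Q.V} (a : Q.A) (p : WPath Q (Q.src a) j) : WPath Q (Q.tgt a) j

namespace WPath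

variable {Q : Quiv}

/-- Composition of weak paths: `p.comp q` traverses `p` first and then `q`. -/
def comp : ∀ {i j k : Q.V}, WPath Q i j → WPath Q j k → WPath Q i k
  | _, _, _, .nil _, q => q
  | _, _, _, .fwd a p, q => .fwd a (p.comp q)
  | _, _, _, .bwd a p, q => .bwd a (p.comp q)

/-- Transport a weak path along equalities of its endpoints. -/
def cast {i i' j j' : Q.V} (hi : i = i') (hj : j = j') (p : WPath Q i j) :
    WPath Q i' j' := by
  cases hi; cases hj; exact p

/-- The formal inverse of a weak path. -/
def reverse : ∀ {i j : Q.V}, WPath Q i j → WPath Q j i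
  | _, _, .nil i => .nil i
  | _, _, .fwd a p => p.reverse.comp (.bwd a (.nil _))
  | _, _, .bwd a p => p.reverse.comp (.fwd a (.nil _))

/-- The content of a weak path: each arrow is counted with `+1`, each inverse
arrow with `-1`. -/
def content : ∀ {i j : Q.V}, WPath Q i j → (Q.A → ℤ)
  | _, _, .nil _ => 0
  | _, _, .fwd a p => (fun b => if b = a then 1 else 0) + p.content
  | _, _, .bwd a p => (fun b => if b = a then -1 else 0) + p.content

/-- Natural number powers of a weak cycle. -/
def npow {i : Q.V} (c : WPath Q i i) : ℕ → WPath Q i i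
  | 0 => .nil i
  | n + 1 => c.comp (npow c n)

/-- Integer powers of a weak cycle. -/
def zpow {i : Q.V} (c : WPath Q i i) (k : ℤ) : WPath Q i i :=
  if 0 ≤ k then c.npow k.toNat else c.reverse.npow (-k).toNat

end WPath

/-- The weak path underlying a strict path. -/
def Path.toWeak {Q : Quiv} : ∀ {i j : Q.V}, Path Q i j → WPath Q i j
  | _, _, .nil i => .nil i
  | _, _, .cons a p => .fwd a p.toWeak

/-- A morphism of quivers. -/
structure Hom (Q Q' : Quiv) where
  onV : Q.V → Q'.V
  onA : Q.A → Q'.A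
  src_comm : ∀ a, Q'.src (onA a) = onV (Q.src a)
  tgt_comm : ∀ a, Q'.tgt (onA a) = onV (Q.tgt a)

/-- The image of a strict path under a morphism of quivers. -/
def Path.map {Q Q' : Quiv} (φ : Hom Q Q') :
    ∀ {i j : Q.V}, Path Q i j → Path Q' (φ.onV i) (φ.onV j)
  | _, _, .nil i => .nil _
  | _, _, .cons a p =>
      ((((Path.single (φ.onA a)).cast rfl (φ.tgt_comm a)).comp (p.map φ)).cast
        (φ.src_comm a) rfl)

/-- The image of a weak path under a morphism of quivers. -/
def WPath.map {Q Q' : Quiv} (φ : Hom Q Q') :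
    ∀ {i j : Q.V}, WPath Q i j → WPath Q' (φ.onV i) (φ.onV j)
  | _, _, .nil i => .nil _
  | _, _, .fwd a p =>
      ((WPath.fwd (φ.onA a) ((p.map φ).cast (φ.tgt_comm a).symm rfl)).cast
        (φ.src_comm a) rfl)
  | _, _, .bwd a p =>
      ((WPath.bwd (φ.onA a) ((p.map φ).cast (φ.src_comm a).symm rfl)).cast
        (φ.tgt_comm a) rfl)

/-- The smallest equivalence relation on strict paths which contains `R` and is
stable under pre- and post-composition with strict paths. -/
inductive PEquiv (Q : Quiv) (R : ∀ ⦃i j : Q.V⦄, Path Q i j → Path Q i j → Prop) :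
    ∀ ⦃i j : Q.V⦄, Path Q i j → Path Q i j → Prop
  | base {i j : Q.V} {p q : Path Q i j} : R p q → PEquiv Q R p q
  | refl {i j : Q.V} (p : Path Q i j) : PEquiv Q R p p
  | symm {i j : Q.V} {p q : Path Q i j} : PEquiv Q R p q → PEquiv Q R q p
  | trans {i j : Q.V} {p q r : Path Q i j} :
      PEquiv Q R p q → PEquiv Q R q r → PEquiv Q R p r
  | comp {i j k l : Q.V} (u : Path Q i j) {p q : Path Q j k} (v : Path Q k l) :
      PEquiv Q R p q → PEquiv Q R (u.comp (p.comp v)) (u.comp (q.comp v))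

/-- The smallest equivalence relation on weak paths which contains `R`, contains
the cancellation relations `a a⁻¹ ∼ 1 ∼ a⁻¹ a`, and is stable under pre- and
post-composition with weak paths. -/
inductive WEquiv (Q : Quiv) (R : ∀ ⦃i j : Q.V⦄, WPath Q i j → WPath Q i j → Prop) :
    ∀ ⦃i j : Q.V⦄, WPath Q i j → WPath Q i j → Prop
  | base {i j : Q.V} {p q : WPath Q i j} : R p q → WEquiv Q R p q
  | cancel_fwd (a : Q.A) :
      WEquiv Q R (WPath.fwd a (WPath.bwd a (WPath.nil _))) (WPath.nil _)
  | cancel_bwd (a : Q.A) :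
      WEquiv Q R (WPath.bwd a (WPath.fwd a (WPath.nil _))) (WPath.nil _)
  | refl {i j : Q.V} (p : WPath Q i j) : WEquiv Q R p p
  | symm {i j : Q.V} {p q : WPath Q i j} : WEquiv Q R p q → WEquiv Q R q p
  | trans {i j : Q.V} {p q r : WPath Q i j} :
      WEquiv Q R p q → WEquiv Q R q r → WEquiv Q R p r
  | comp {i j k l : Q.V} (u : WPath Q i j) {p q : WPath Q j k} (v : WPath Q k l) :
      WEquiv Q R p q → WEquiv Q R (u.comp (p.comp v)) (u.comp (q.comp v))

end Quiv

open Quiv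

/-- A brane tiling, encoded through its dual quiver together with its face
structure.  For each arrow `a`, `wface true a` (resp. `wface false a`) is the
complementary path of `a` in the unique positive (resp. negative) face
containing `a`, so that the boundary cycle of that face based at `Q.src a` is
`a` followed by `wface s a`.  The field `rot` expresses that the face cycles
are compatible with rotation, i.e. that the faces are genuine cyclic faces. -/
structure BraneTiling where
  Q : Quiv
  fintV : Fintype Q.V
  fintA : Fintype Q.A
  wface : Bool → ∀ a : Q.A, Quiv.Path Q (Q.tgt a) (Q.src a)
  rot : ∀ (s : Bool) (a b : Q.A) (p : Quiv.Path Q (Q.tgt b) (Q.src a)),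
    HEq (wface s a) (Quiv.Path.cons b p) →
      HEq (wface s b) (p.comp (Quiv.Path.single a))

attribute [instance] BraneTiling.fintV BraneTiling.fintA

namespace BraneTiling

variable (B : BraneTiling)

/-- The boundary cycle, based at `Q.src a`, of the positive (`s = true`) or
negative (`s = false`) face containing the arrow `a`. -/
def faceCycle (s : Bool) (a : B.Q.A) : Path B.Q (B.Q.src a) (B.Q.src a) :=
  Path.cons a (B.wface s a)

/-- `d₂(F)` for the face of sign `s` through `a`: the content of its boundary. -/
def faceContent (s : Bool) (a : B.Q.A) : B.Q.A → ℤ := (B.faceCycle s a).content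

/-- The list of arrows on the boundary of the face of sign `s` through `a`. -/
def cycleArrows (s : Bool) (a : B.Q.A) : List B.Q.A := (B.faceCycle s a).arrows

/-- A perfect matching (of the bipartite graph dual to the quiver): a set of
arrows such that every face contains exactly one arrow of the set. -/
def IsMatching (S : Set B.Q.A) : Prop :=
  ∀ (s : Bool) (a : B.Q.A),
    (B.cycleArrows s a).countP (fun x => decide (x ∈ S)) = 1

/-- The brane tiling is non-degenerate if every edge belongs to some perfect
matching. -/
def NonDegenerate : Prop :=
  ∀ a : B.Q.A, ∃ S : Set B.Q.A, B.IsMatching S ∧ a ∈ S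

/-- The subgroup of `ℤ^{Q₁}` generated by the differences `d₂(F) - d₂(F')` of
the contents of faces. -/
def lamRel : Submodule ℤ (B.Q.A → ℤ) :=
  Submodule.span ℤ
    {x | ∃ (s : Bool) (a : B.Q.A) (t : Bool) (b : B.Q.A),
      x = B.faceContent s a - B.faceContent t b}

/-- The weight group `Λ = ℤ^{Q₁} / ⟨d₂(F) - d₂(F') : F, F' ∈ Q₂⟩`. -/
def Lam : Type := (B.Q.A → ℤ) ⧸ B.lamRel

instance : AddCommGroup B.Lam := by unfold Lam; infer_instance
instance : Module ℤ B.Lam := by unfold Lam; infer_instance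

/-- The weight function `ℤ^{Q₁} → Λ` (the canonical projection). -/
def wt : (B.Q.A → ℤ) →ₗ[ℤ] B.Lam := B.lamRel.mkQ

/-- The weight of a strict path. -/
def wtP {i j : B.Q.V} (p : Path B.Q i j) : B.Lam := B.wt p.content

/-- The weight of a weak path. -/
def wtW {i j : B.Q.V} (p : WPath B.Q i j) : B.Lam := B.wt p.content

/-- The weight of an arrow. -/
def wtA (a : B.Q.A) : B.Lam := B.wt ((Path.single a).content)

/-- The weight `ω̄` of a face cycle (in `Λ` it does not depend on the face). -/
def omegaBarAt (a : B.Q.A) : B.Lam := B.wt (B.faceContent true a)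

end BraneTiling

namespace BraneTiling

variable (B : BraneTiling)

/-- The real span of the differences of face contents, inside `ℝ^{Q₁}`. -/
def lamRelR : Submodule ℝ (B.Q.A → ℝ) :=
  Submodule.span ℝ
    {x | ∃ (s : Bool) (a : B.Q.A) (t : Bool) (b : B.Q.A),
      x = (fun c => (B.faceContent s a c : ℝ)) - fun c => (B.faceContent t b c : ℝ)}

/-- The real weight space `Λ_ℝ = Λ ⊗_ℤ ℝ`, realized as the corresponding
quotient of `ℝ^{Q₁}`. -/
def LamR : Type := (B.Q.A → ℝ) ⧸ B.lamRelR

instance : AddCommGroup B.LamR := by unfold LamR; infer_instance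
instance : Module ℝ B.LamR := by unfold LamR; infer_instance

/-- The real weight function. -/
def wtR : (B.Q.A → ℝ) →ₗ[ℝ] B.LamR := B.lamRelR.mkQ

/-- The image in `Λ_ℝ` of an arrow. -/
def wtRA (a : B.Q.A) : B.LamR := B.wtR (fun b => if b = a then 1 else 0)

/-- The cone in `Λ_ℝ` generated by the arrows of `Q`: all combinations of the
classes of arrows with non-negative real coefficients. -/
def arrowCone : Set B.LamR :=
  {v | ∃ x : B.Q.A → ℝ, (∀ a, 0 ≤ x a) ∧ v = ∑ a, x a • B.wtRA a}

end BraneTiling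

theorem List.sum_map_ite_one_zero {α : Type*} (p : α → Prop) (l : List α) :
    (l.map fun a => if p a then (1 : ℤ) else 0).sum = l.countP (fun a => decide (p a)) := by
  induction l with
  | nil => simp
  | cons a l ih => by_cases h : p a <;> simp [h, ih, add_comm]

namespace Quiv.Path

variable {Q : Quiv}

/-- Pairing a function on arrows with the content of a path sums it along the path. -/
theorem sum_mul_content [Fintype Q.A] (f : Q.A → ℤ) {i j : Q.V} (p : Path Q i j) :
    ∑ c, f c * p.content c = (p.arrows.map f).sum := by
  induction p with
  | nil i => simp [content, arrows]
  | cons a p ih => simp [content, arrows, mul_add, Finset.sum_add_distrib, ih]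

end Quiv.Path

namespace BraneTiling

variable (B : BraneTiling)

/-- A strictly positive grading of the arrows for which all faces have the same degree. -/
def IsPositiveGrading (f : B.Q.A → ℤ) : Prop :=
  (∀ a, 0 < f a) ∧ ∃ k : ℤ, ∀ s a, ∑ c, f c * B.faceContent s a c = k

/-- The number of selected perfect matchings through each arrow is a positive grading. -/
theorem NonDegenerate.exists_isPositiveGrading {B : BraneTiling} (h : B.NonDegenerate) :
    ∃ f, B.IsPositiveGrading f := by
  choose S hS hmem using h
  refine ⟨fun c => ∑ b, if c ∈ S b then 1 else 0, fun a => ?_, Fintype.card B.Q.A, ?_⟩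
  · refine Finset.sum_pos' (fun b _ => by split_ifs <;> simp) ⟨a, Finset.mem_univ a, ?_⟩
    simp [hmem]
  · intro s a
    have hone (b : B.Q.A) :
        ∑ c, (if c ∈ S b then (1 : ℤ) else 0) * B.faceContent s a c = 1 := by
      rw [faceContent, Path.sum_mul_content, List.sum_map_ite_one_zero]
      exact_mod_cast hS b s a
    simp_rw [Finset.sum_mul]
    rw [Finset.sum_comm, Finset.sum_congr rfl fun b _ => hone b]
    simp

/-- If all faces have the same length, giving every arrow degree one is a positive grading. -/
theorem isPositiveGrading_one
    (h : ∀ (s : Bool) (a : B.Q.A) (t : Bool) (b : B.Q.A),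
      (B.cycleArrows s a).length = (B.cycleArrows t b).length) :
    B.IsPositiveGrading 1 := by
  refine ⟨fun _ => one_pos, ?_⟩
  have hlen (s : Bool) (a : B.Q.A) :
      ∑ c, (1 : B.Q.A → ℤ) c * B.faceContent s a c = (B.cycleArrows s a).length := by
    rw [faceContent, Path.sum_mul_content, cycleArrows]
    simp [Pi.one_def]
  rcases isEmpty_or_nonempty B.Q.A with _ | ⟨⟨a₀⟩⟩
  · exact ⟨0, fun _ a => isEmptyElim a⟩
  · exact ⟨(B.cycleArrows true a₀).length, fun s a => by rw [hlen, h s a true a₀]⟩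

namespace IsPositiveGrading

variable {B} {f : B.Q.A → ℤ}

theorem sum_eq_zero_of_mem_lamRel (hf : B.IsPositiveGrading f) {x : B.Q.A → ℤ}
    (hx : x ∈ B.lamRel) : ∑ c, f c * x c = 0 := by
  obtain ⟨k, hk⟩ := hf.2
  induction hx using Submodule.span_induction with
  | mem x hx =>
    obtain ⟨s, a, t, b, rfl⟩ := hx
    simp [mul_sub, Finset.sum_sub_distrib, hk]
  | zero => simp
  | add x y _ _ hx hy => simp [mul_add, Finset.sum_add_distrib, hx, hy]
  | smul r x _ hx => simp [mul_left_comm, ← Finset.mul_sum, hx]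

theorem sum_eq_zero_of_mem_lamRelR (hf : B.IsPositiveGrading f) {x : B.Q.A → ℝ}
    (hx : x ∈ B.lamRelR) : ∑ c, (f c : ℝ) * x c = 0 := by
  obtain ⟨k, hk⟩ := hf.2
  have hkR (s : Bool) (a : B.Q.A) : ∑ c, (f c : ℝ) * (B.faceContent s a c : ℝ) = k := by
    exact_mod_cast hk s a
  induction hx using Submodule.span_induction with
  | mem x hx =>
    obtain ⟨s, a, t, b, rfl⟩ := hx
    simp [mul_sub, Finset.sum_sub_distrib, hkR]
  | zero => simp
  | add x y _ _ hx hy => simp [mul_add, Finset.sum_add_distrib, hx, hy]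
  | smul r x _ hx => simp [mul_left_comm, ← Finset.mul_sum, hx]

theorem eq_zero_of_wt_eq_zero (hf : B.IsPositiveGrading f) {x : B.Q.A → ℤ} (hx : 0 ≤ x)
    (h : B.wt x = 0) : x = 0 := by
  have hsum := hf.sum_eq_zero_of_mem_lamRel ((Submodule.Quotient.mk_eq_zero _).mp h)
  rw [Finset.sum_eq_zero_iff_of_nonneg fun c _ => mul_nonneg (hf.1 c).le (hx c)] at hsum
  ext c
  exact (mul_eq_zero.mp (hsum c (Finset.mem_univ c))).resolve_left (hf.1 c).ne'

theorem eq_zero_of_wtR_eq_zero (hf : B.IsPositiveGrading f) {x : B.Q.A → ℝ} (hx : 0 ≤ x)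
    (h : B.wtR x = 0) : x = 0 := by
  have hpos (c : B.Q.A) : (0 : ℝ) < f c := by exact_mod_cast hf.1 c
  have hsum := hf.sum_eq_zero_of_mem_lamRelR ((Submodule.Quotient.mk_eq_zero _).mp h)
  rw [Finset.sum_eq_zero_iff_of_nonneg fun c _ => mul_nonneg (hpos c).le (hx c)] at hsum
  ext c
  exact (mul_eq_zero.mp (hsum c (Finset.mem_univ c))).resolve_left (hpos c).ne'

end IsPositiveGrading

theorem sum_smul_wtRA (x : B.Q.A → ℝ) : ∑ a, x a • B.wtRA a = B.wtR x := by
  simp_rw [wtRA, ← map_smul, ← map_sum]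
  congr 1
  ext c
  simp

end BraneTiling

/-- Let `G` be a brane tiling with dual quiver `Q`, weight
group `Λ` and weight function `wt : ℤ^{Q₁} → Λ`.  Assume that either (1) the
bipartite graph `G` is non-degenerate, or (2) all faces of `Q` contain the same
number of arrows.  Then for any `(x_a) ∈ ℕ^{Q₁} ∖ {0}`, the element
`Σ_a x_a·wt(a)` is non-zero in `Λ`.  Consequently the arrows of `Q` generate a
strongly convex cone in `Λ ⊗_ℤ ℝ` (the cone contains no pair `v, -v` of
opposite non-zero vectors). -/
theorem wt_ne_zero_and_strongly_convex (B : BraneTiling)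
    (h : B.NonDegenerate ∨
      (∀ (s : Bool) (a : B.Q.A) (t : Bool) (b : B.Q.A),
        (B.cycleArrows s a).length = (B.cycleArrows t b).length)) :
    (∀ x : B.Q.A → ℕ, x ≠ 0 → B.wt (fun a => (x a : ℤ)) ≠ 0) ∧
      (∀ v ∈ B.arrowCone, -v ∈ B.arrowCone → v = 0) := by
  obtain ⟨f, hf⟩ : ∃ f, B.IsPositiveGrading f :=
    h.elim (fun h => h.exists_isPositiveGrading) fun h => ⟨1, B.isPositiveGrading_one h⟩
  refine ⟨fun x hx h0 => hx ?_, ?_⟩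
  · have := hf.eq_zero_of_wt_eq_zero (fun a => Int.natCast_nonneg (x a)) h0
    ext a
    simpa using congrFun this a
  · rintro v ⟨x, hx, rfl⟩ ⟨y, hy, hxy⟩
    rw [B.sum_smul_wtRA] at hxy ⊢
    rw [B.sum_smul_wtRA] at hxy
    have hsum : x + y = 0 := hf.eq_zero_of_wtR_eq_zero
      (fun a => add_nonneg (hx a) (hy a)) (by rw [map_add, ← hxy, add_neg_cancel])
    have hx0 : x = 0 := ((add_eq_zero_iff_of_nonneg hx hy).mp hsum).1
    rw [hx0, map_zero]
end
end

section
/- Let (Q, W) arise from a brane tiling, let Q̃ be the periodic quiver on the universal cover of the torus, and let ∼ be the weak equivalence relation on weak paths in Q̃. Then for any weak path u : i → j in Q̃ one has u ω_i ∼ ω_j u, where ω_i denotes the equivalence class of the cycles along faces of Q̃ based at i. -/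
open scoped Classical

noncomputable section

open Quiv

namespace BraneTiling

variable (B : BraneTiling)

/-- The relations `∂W/∂a`: for each arrow `a`, the complementary path of `a` in
its positive face is identified with the complementary path of `a` in its
negative face. -/
inductive dWRel : ∀ ⦃i j : B.Q.V⦄, Path B.Q i j → Path B.Q i j → Prop
  | mk (a : B.Q.A) : dWRel (B.wface true a) (B.wface false a)

/-- The relations `∂W/∂a`, viewed on weak paths. -/
inductive dWRelW : ∀ ⦃i j : B.Q.V⦄, WPath B.Q i j → WPath B.Q i j → Prop
  | mk (a : B.Q.A) : dWRelW ((B.wface true a).toWeak) ((B.wface false a).toWeak)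

/-- Strict equivalence of paths: the equivalence relation `(∂W)` on strict paths. -/
def SEquiv : ∀ ⦃i j : B.Q.V⦄, Path B.Q i j → Path B.Q i j → Prop :=
  PEquiv B.Q B.dWRel

/-- Weak equivalence of weak paths in `Q`. -/
def WkEquiv : ∀ ⦃i j : B.Q.V⦄, WPath B.Q i j → WPath B.Q i j → Prop :=
  WEquiv B.Q B.dWRelW

end BraneTiling

/-- The periodic quiver `Q̃` of a brane tiling: the inverse image of the quiver
`Q` in the universal cover of the torus, encoded as a covering of quivers with
unique lifting of arrows, together with the lifted face structure. -/
structure Periodic (B : BraneTiling) where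
  tQ : Quiv
  proj : Quiv.Hom tQ B.Q
  liftSrc : ∀ (a : B.Q.A) (i : tQ.V), proj.onV i = B.Q.src a →
    ∃! a' : tQ.A, proj.onA a' = a ∧ tQ.src a' = i
  liftTgt : ∀ (a : B.Q.A) (i : tQ.V), proj.onV i = B.Q.tgt a →
    ∃! a' : tQ.A, proj.onA a' = a ∧ tQ.tgt a' = i
  surjV : Function.Surjective proj.onV
  twface : Bool → ∀ a : tQ.A, Quiv.Path tQ (tQ.tgt a) (tQ.src a)
  proj_twface : ∀ (s : Bool) (a : tQ.A),
    (twface s a).map proj =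
      (B.wface s (proj.onA a)).cast (proj.tgt_comm a) (proj.src_comm a)

namespace Periodic

variable {B : BraneTiling} (P : Periodic B)

/-- The boundary cycle, based at `src a`, of the face of sign `s` of the
periodic quiver containing the arrow `a`. -/
def faceCycle (s : Bool) (a : P.tQ.A) : Path P.tQ (P.tQ.src a) (P.tQ.src a) :=
  Path.cons a (P.twface s a)

/-- Pairs of boundary cycles of faces of the periodic quiver with the same
endpoints. -/
inductive faceRel : ∀ ⦃i j : P.tQ.V⦄, WPath P.tQ i j → WPath P.tQ i j → Prop
  | mk (s t : Bool) (a b : P.tQ.A) (h : P.tQ.src b = P.tQ.src a) :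
      faceRel ((P.faceCycle s a).toWeak) (((P.faceCycle t b).toWeak).cast h h)

/-- Weak equivalence of weak paths in the periodic quiver: the equivalence
relation generated by identifying any two boundary cycles of faces with the
same endpoints (stable under composition). -/
def WkEquiv : ∀ ⦃i j : P.tQ.V⦄, WPath P.tQ i j → WPath P.tQ i j → Prop :=
  WEquiv P.tQ P.faceRel

/-- The weight of a weak path of the periodic quiver. -/
def wtW {i j : P.tQ.V} (u : WPath P.tQ i j) : B.Lam := B.wt ((u.map P.proj).content)

/-- The weight of a strict path of the periodic quiver. -/
def wtP {i j : P.tQ.V} (u : Path P.tQ i j) : B.Lam := B.wt ((u.map P.proj).content)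

/-- A strict path `u : i → j` of the periodic quiver is a shortest path if any
strict path from `i` to `j` is weakly equivalent to `u ω^k` for some `k ≥ 0`. -/
def Shortest {i j : P.tQ.V} (u : Path P.tQ i j) : Prop :=
  ∀ p : Path P.tQ i j, ∃ (s : Bool) (a : P.tQ.A) (h : P.tQ.src a = i) (k : ℕ),
    P.WkEquiv p.toWeak
      (((((P.faceCycle s a).toWeak).npow k).cast h h).comp u.toWeak)

end Periodic

namespace Quiv

namespace Path

variable {Q : Quiv}

theorem arrows_cast {i i' j j' : Q.V} (hi : i = i') (hj : j = j') (p : Path Q i j) :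
    (p.cast hi hj).arrows = p.arrows := by
  cases hi; cases hj; rfl

theorem arrows_comp {i j k : Q.V} (p : Path Q i j) (q : Path Q j k) :
    (p.comp q).arrows = p.arrows ++ q.arrows := by
  induction p with
  | nil => rfl
  | cons a p ih => simp [comp, arrows, ih]

theorem arrows_single (a : Q.A) : (single a).arrows = [a] := rfl

theorem arrows_map {Q' : Quiv} (φ : Hom Q Q') {i j : Q.V} (p : Path Q i j) :
    (p.map φ).arrows = p.arrows.map φ.onA := by
  induction p with
  | nil => rfl
  | cons a p ih => simp [map, arrows, arrows_cast, arrows_comp, arrows_single, ih]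

/-- A path is determined by its endpoints and the list of arrows it traverses. -/
theorem heq_of_arrows_eq {i j i' j' : Q.V} (p : Path Q i j) (q : Path Q i' j')
    (hi : i = i') (hj : j = j') (h : p.arrows = q.arrows) : HEq p q := by
  induction p generalizing i' with
  | nil i =>
    cases q with
    | nil => cases hi; rfl
    | cons b q => simp [arrows] at h
  | cons a p ih =>
    cases q with
    | nil => simp [arrows] at h
    | cons b q =>
      simp only [arrows, List.cons.injEq] at h
      obtain ⟨rfl, h⟩ := h
      subst hj
      rw [eq_of_heq (ih q rfl rfl h)]

theorem eq_of_arrows_eq {i j : Q.V} (p q : Path Q i j) (h : p.arrows = q.arrows) : p = q :=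
  eq_of_heq (heq_of_arrows_eq p q rfl rfl h)

/-- A path is either trivial or begins with an arrow. -/
theorem nil_or_cons {i j : Q.V} (p : Path Q i j) :
    (i = j ∧ p.arrows = []) ∨
      ∃ (b : Q.A) (_ : Q.src b = i) (q : Path Q (Q.tgt b) j), p.arrows = b :: q.arrows := by
  cases p with
  | nil => exact .inl ⟨rfl, rfl⟩
  | cons b q => exact .inr ⟨b, rfl, q, rfl⟩

theorem toWeak_comp {i j k : Q.V} (p : Path Q i j) (q : Path Q j k) :
    (p.comp q).toWeak = p.toWeak.comp q.toWeak := by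
  induction p with
  | nil => rfl
  | cons a p ih => simp [comp, toWeak, WPath.comp, ih]

theorem toWeak_cast {i i' j j' : Q.V} (hi : i = i') (hj : j = j') (p : Path Q i j) :
    (p.cast hi hj).toWeak = p.toWeak.cast hi hj := by
  cases hi; cases hj; rfl

end Path

namespace WPath

variable {Q : Quiv}

theorem comp_nil {i j : Q.V} (p : WPath Q i j) : p.comp (.nil j) = p := by
  induction p with
  | nil => rfl
  | fwd a p ih => simp [comp, ih]
  | bwd a p ih => simp [comp, ih]

theorem comp_assoc {i j k l : Q.V} (p : WPath Q i j) (q : WPath Q j k) (r : WPath Q k l) :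
    (p.comp q).comp r = p.comp (q.comp r) := by
  induction p with
  | nil => rfl
  | fwd a p ih => simp [comp, ih]
  | bwd a p ih => simp [comp, ih]

end WPath

namespace WEquiv

variable {Q : Quiv} {R : ∀ ⦃i j : Q.V⦄, WPath Q i j → WPath Q i j → Prop}

theorem comp_right {i j k : Q.V} {p q : WPath Q i j} (h : WEquiv Q R p q) (v : WPath Q j k) :
    WEquiv Q R (p.comp v) (q.comp v) :=
  .comp (.nil i) v h

theorem comp_left {i j k : Q.V} (u : WPath Q i j) {p q : WPath Q j k} (h : WEquiv Q R p q) :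
    WEquiv Q R (u.comp p) (u.comp q) := by
  simpa only [WPath.comp_nil] using WEquiv.comp u (.nil k) h

end WEquiv

end Quiv

namespace Periodic

variable {B : BraneTiling} (P : Periodic B)

/-- Uniqueness of path lifting along the covering. -/
theorem arrows_eq_of_map_eq {i j i' j' : P.tQ.V} (p : Path P.tQ i j) (q : Path P.tQ i' j')
    (hi : i = i') (h : p.arrows.map P.proj.onA = q.arrows.map P.proj.onA) :
    p.arrows = q.arrows := by
  induction p generalizing i' with
  | nil i =>
    cases q with
    | nil => rfl
    | cons b q => simp [Path.arrows] at h
  | cons a p ih =>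
    cases q with
    | nil => simp [Path.arrows] at h
    | cons b q =>
      simp only [Path.arrows, List.map_cons, List.cons.injEq] at h
      obtain rfl : a = b :=
        (P.liftSrc (P.proj.onA a) (P.tQ.src a) (P.proj.src_comm a).symm).unique
          ⟨rfl, rfl⟩ ⟨h.1.symm, hi.symm⟩
      simp only [Path.arrows, ih q rfl h.2]

theorem map_arrows_twface (s : Bool) (a : P.tQ.A) :
    (P.twface s a).arrows.map P.proj.onA = (B.wface s (P.proj.onA a)).arrows := by
  rw [← Path.arrows_map, P.proj_twface, Path.arrows_cast]

/-- The face cycles of the periodic quiver are compatible with rotation. -/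
theorem arrows_twface_rotate (s : Bool) (a b : P.tQ.A) (h : P.tQ.src b = P.tQ.tgt a)
    (p : Path P.tQ (P.tQ.tgt b) (P.tQ.src a))
    (hp : (P.twface s a).arrows = b :: p.arrows) :
    (P.twface s b).arrows = p.arrows ++ [a] := by
  have hrot := B.rot s (P.proj.onA a) (P.proj.onA b)
    ((p.map P.proj).cast (P.proj.tgt_comm b).symm (P.proj.src_comm a).symm)
    (Path.heq_of_arrows_eq _ _
      (by rw [P.proj.tgt_comm, P.proj.src_comm, h]) rfl
      (by rw [← map_arrows_twface, hp]
          simp [Path.arrows, Path.arrows_cast, Path.arrows_map]))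
  have hsrc : B.Q.src (P.proj.onA b) = B.Q.tgt (P.proj.onA a) := by
    rw [P.proj.tgt_comm, P.proj.src_comm, h]
  have harr := congrArg Path.arrows (eq_of_heq
    ((Path.heq_of_arrows_eq ((B.wface s (P.proj.onA b)).cast rfl hsrc) _ rfl hsrc.symm
      (Path.arrows_cast _ _ _)).trans hrot))
  rw [Path.arrows_cast, Path.arrows_comp, Path.arrows_cast, Path.arrows_map,
    Path.arrows_single] at harr
  rw [← Path.arrows_single, ← Path.arrows_comp]
  refine P.arrows_eq_of_map_eq _ _ rfl ?_
  rw [map_arrows_twface, harr, Path.arrows_comp, Path.arrows_single, List.map_append,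
    List.map_singleton]

/-- The boundary cycle of a face through `a`, rotated to start at the target of `a`, is
again a face cycle. -/
theorem exists_faceCycle_eq_rotate (s : Bool) (a : P.tQ.A) :
    ∃ (b : P.tQ.A) (h : P.tQ.src b = P.tQ.tgt a),
      (P.twface s a).comp (Path.single a) = (P.faceCycle s b).cast h h := by
  rcases (P.twface s a).nil_or_cons with ⟨h, hnil⟩ | ⟨b, h, p, hp⟩
  · refine ⟨a, h.symm, Path.eq_of_arrows_eq _ _ ?_⟩
    simp [Path.arrows_comp, Path.arrows_cast, faceCycle, Path.arrows, Path.arrows_single, hnil]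
  · refine ⟨b, h, Path.eq_of_arrows_eq _ _ ?_⟩
    simp [Path.arrows_comp, Path.arrows_cast, faceCycle, Path.arrows, Path.arrows_single, hp,
      P.arrows_twface_rotate s a b h p hp]

/-- Any two face cycles with the same base point are weakly equivalent. -/
theorem wkEquiv_faceCycle {i : P.tQ.V} (s t : Bool) (a b : P.tQ.A)
    (ha : P.tQ.src a = i) (hb : P.tQ.src b = i) :
    P.WkEquiv ((P.faceCycle s a).toWeak.cast ha ha) ((P.faceCycle t b).toWeak.cast hb hb) := by
  subst ha
  exact .base (.mk s t a b hb)

end Periodic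

/-- Let `(Q, W)` arise from a brane tiling, let `Q̃` be the
periodic quiver on the universal cover of the torus, and let `∼` be the weak
equivalence relation on weak paths in `Q̃`.  Then for any weak path `u : i → j`
in `Q̃` one has `u ω_i ∼ ω_j u`, where `ω_i` denotes the equivalence class of
the boundary cycles of faces of `Q̃` based at `i`:  explicitly, for any face
cycle `c` based at `i` and any face cycle `d` based at `j`, traversing `c` and
then `u` is weakly equivalent to traversing `u` and then `d`. -/
theorem omega_commutes (B : BraneTiling) (P : Periodic B) (i j : P.tQ.V)
    (u : Quiv.WPath P.tQ i j)
    (s : Bool) (a : P.tQ.A) (ha : P.tQ.src a = i)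
    (t : Bool) (b : P.tQ.A) (hb : P.tQ.src b = j) :
    P.WkEquiv ((((P.faceCycle s a).toWeak).cast ha ha).comp u)
      (u.comp (((P.faceCycle t b).toWeak).cast hb hb)) := by
  induction u generalizing s a with
  | nil i =>
    rw [WPath.comp_nil]
    exact P.wkEquiv_faceCycle s t a b ha hb
  | fwd e p ih =>
    obtain ⟨f, hf, hrot⟩ := P.exists_faceCycle_eq_rotate true e
    have hw := congrArg Path.toWeak hrot
    rw [Path.toWeak_comp, Path.toWeak_cast] at hw
    have key : ((P.faceCycle true e).toWeak).comp (.fwd e p) =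
        .fwd e (((P.faceCycle true f).toWeak.cast hf hf).comp p) := by
      rw [← hw, WPath.comp_assoc]
      rfl
    refine ((P.wkEquiv_faceCycle s true a e ha rfl).comp_right _).trans ?_
    refine Eq.mp (congrArg (P.WkEquiv · _) key.symm) ?_
    exact (ih true f hf hb).comp_left (.fwd e (.nil _))
  | bwd e p ih =>
    obtain ⟨f, hf, hrot⟩ := P.exists_faceCycle_eq_rotate true e
    have hw := congrArg Path.toWeak hrot
    rw [Path.toWeak_comp, Path.toWeak_cast] at hw
    refine ((P.wkEquiv_faceCycle s true a f ha hf).comp_right _).trans ?_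
    rw [← hw, WPath.comp_assoc]
    refine (WEquiv.comp (P.twface true e).toWeak p (.cancel_fwd e)).trans ?_
    refine (WEquiv.comp_right (.cancel_bwd e) ((P.twface true e).toWeak.comp p)).symm.trans ?_
    exact (ih true e rfl hb).comp_left (.bwd e (.nil _))
end
end

section
/- Let (Q, W) arise from a non-degenerate brane tiling satisfying both consistency conditions, fix i_0 ∈ Q̃_0, and let I_0 = I(∅) be the canonical perfect matching, I_0 = { a : i → j : a v_i > v_j }. Then for any perfect matching I of the plane tiling defined by Q̃ that is congruent to I_0 (i.e. the symmetric difference of I and I_0 is finite), there exists a unique finite ideal Ω of Δ such that I(Ω) = I; this ideal equals Ω′ ∩ Δ, where Ω′ is the minimal ideal in Δ′ containing Q̃_0 × ℤ_{<0} such that for every arrow a ∉ I and every u ∈ Ω′_{s(a)} one has au ∈ Ω′_{t(a)}. -/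
open scoped Classical

noncomputable section

open Quiv

/-- The first consistency condition: two paths in `Q` with the same startpoint
are strictly equivalent if and only if their weights are equal. -/
def BraneTiling.Consistent1 (B : BraneTiling) : Prop :=
  ∀ (i j j' : B.Q.V) (u : Quiv.Path B.Q i j) (v : Quiv.Path B.Q i j'),
    (∃ h : j = j', B.SEquiv (u.cast rfl h) v) ↔ B.wtP u = B.wtP v

/-- The second consistency condition: every shortest path of the periodic
quiver can be extended by an arrow at its target (and, dually, at its source)
to a shortest path. -/
def Periodic.Consistent2 {B : BraneTiling} (P : Periodic B) : Prop :=
  ∀ (i j : P.tQ.V) (u : Quiv.Path P.tQ i j), P.Shortest u →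
    (∃ (a : P.tQ.A) (h : P.tQ.src a = j),
      P.Shortest (u.comp ((Quiv.Path.single a).cast h rfl))) ∧
    (∃ (b : P.tQ.A) (h : P.tQ.tgt b = i),
      P.Shortest (((Quiv.Path.single b).cast rfl h).comp u))

namespace Periodic

variable {B : BraneTiling} (P : Periodic B)

/-- A perfect matching of the plane tiling defined by the periodic quiver: a
set of arrows such that every face of `Q̃` contains exactly one arrow of it. -/
def IsMatching (S : Set P.tQ.A) : Prop :=
  ∀ (s : Bool) (a : P.tQ.A),
    ((P.faceCycle s a).arrows).countP (fun x => decide (x ∈ S)) = 1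

end Periodic

/-- The identification of the poset `Δ = Δ_{i₀}` of weak-equivalence classes of
strict paths of `Q̃` starting at `i₀` with `Q̃₀ × ℕ`, and of the set `Δ′` of
classes of weak paths starting at `i₀` with `Q̃₀ × ℤ`:  it consists of a face
cycle `ω` based at `i₀`, a shortest path `v i : i₀ → i` for every vertex `i`,
and the class function `cl` assigning to a weak path `u : i₀ → j` the unique
`k ∈ ℤ` with `u ∼ ω^k v_j`. -/
structure DeltaData (B : BraneTiling) (P : Periodic B) (i0 : P.tQ.V) where
  omega : Quiv.Path P.tQ i0 i0
  omega_isFace : ∃ (s : Bool) (a : P.tQ.A) (h : P.tQ.src a = i0),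
    omega = (P.faceCycle s a).cast h h
  v : ∀ i : P.tQ.V, Quiv.Path P.tQ i0 i
  v_shortest : ∀ i, P.Shortest (v i)
  cl : ∀ {j : P.tQ.V}, Quiv.WPath P.tQ i0 j → ℤ
  cl_spec : ∀ (j : P.tQ.V) (u : Quiv.WPath P.tQ i0 j),
    P.WkEquiv u ((omega.toWeak.zpow (cl u)).comp (v j).toWeak)
  cl_congr : ∀ (j : P.tQ.V) (u u' : Quiv.WPath P.tQ i0 j),
    P.WkEquiv u u' → cl u = cl u'

namespace DeltaData

variable {B : BraneTiling} {P : Periodic B} {i0 : P.tQ.V} (D : DeltaData B P i0)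

/-- The weak path `ω^k v_i` representing the class `(i, k) ∈ Q̃₀ × ℤ = Δ′`. -/
def el (i : P.tQ.V) (k : ℤ) : Quiv.WPath P.tQ i0 i :=
  (D.omega.toWeak.zpow k).comp (D.v i).toWeak

/-- The partial order on `Δ′ = Q̃₀ × ℤ`: `x ≤ y` iff there is a strict path `w`
with `w·x ∼ y`. -/
def le (x y : P.tQ.V × ℤ) : Prop :=
  ∃ w : Quiv.Path P.tQ x.1 y.1, D.cl ((D.el x.1 x.2).comp w.toWeak) = y.2

/-- Finite ideals of the poset `Δ = Q̃₀ × ℕ`: finite downward closed subsets. -/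
def IsIdeal (Ω : Finset (P.tQ.V × ℕ)) : Prop :=
  ∀ y ∈ Ω, ∀ (i : P.tQ.V) (k : ℕ),
    D.le (i, (k : ℤ)) (y.1, (y.2 : ℤ)) → (i, k) ∈ Ω

/-- Membership in `Ω′ = Ω ∪ (Q̃₀ × ℤ_{<0}) ⊆ Δ′`. -/
def memOm' (_D : DeltaData B P i0) (Ω : Finset (P.tQ.V × ℕ)) (x : P.tQ.V × ℤ) : Prop :=
  x.2 < 0 ∨ (0 ≤ x.2 ∧ (x.1, x.2.toNat) ∈ Ω)

/-- The set of arrows `I(Ω) = { a : i → j | ∃ u ∈ Ω′_i, au ∉ Ω′_j }`. -/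
def matchOf (Ω : Finset (P.tQ.V × ℕ)) : Set P.tQ.A :=
  {a | ∃ k : ℤ, D.memOm' Ω (P.tQ.src a, k) ∧
    ¬ D.memOm' Ω (P.tQ.tgt a,
      D.cl ((D.el (P.tQ.src a) k).comp (Quiv.Path.single a).toWeak))}

end DeltaData

namespace DeltaData

variable {B : BraneTiling} {P : Periodic B} {i0 : P.tQ.V}

/-- The minimal ideal `Ω′` in `Δ′ = Q̃₀ × ℤ` containing `Q̃₀ × ℤ_{<0}` and such
that for every arrow `a ∉ I` and every `u ∈ Ω′_{s(a)}` one has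
`au ∈ Ω′_{t(a)}`. -/
def minOm' (D : DeltaData B P i0) (I : Set P.tQ.A) : Set (P.tQ.V × ℤ) :=
  ⋂₀ {S : Set (P.tQ.V × ℤ) |
    (∀ (i : P.tQ.V) (k : ℤ), k < 0 → (i, k) ∈ S) ∧
    (∀ y ∈ S, ∀ x, D.le x y → x ∈ S) ∧
    (∀ a : P.tQ.A, a ∉ I → ∀ k : ℤ, (P.tQ.src a, k) ∈ S →
      (P.tQ.tgt a,
        D.cl ((D.el (P.tQ.src a) k).comp (Quiv.Path.single a).toWeak)) ∈ S)}

end DeltaData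

/-! ### Lists and permutations -/

theorem List.eq_of_countP_eq_one {α : Type*} {p : α → Bool} {l : List α}
    (h : l.countP p = 1) {x y : α} (hx : x ∈ l) (hpx : p x) (hy : y ∈ l) (hpy : p y) :
    x = y := by
  rw [List.countP_eq_length_filter, List.length_eq_one_iff] at h
  obtain ⟨z, hz⟩ := h
  have hx' : x ∈ l.filter p := List.mem_filter.2 ⟨hx, hpx⟩
  have hy' : y ∈ l.filter p := List.mem_filter.2 ⟨hy, hpy⟩
  rw [hz, List.mem_singleton] at hx' hy'
  rw [hx', hy']

theorem List.exists_split_of_not_nodup_map {α β : Type*} (f : α → β) :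
    ∀ {l : List α}, ¬ (l.map f).Nodup →
      ∃ l₁ a l₂ b l₃, l = l₁ ++ a :: l₂ ++ b :: l₃ ∧ f a = f b
  | [], h => absurd List.nodup_nil h
  | x :: t, h => by
    by_cases ht : (t.map f).Nodup
    · have hx : f x ∈ t.map f := by
        by_contra hx
        exact h (List.nodup_cons.2 ⟨hx, ht⟩)
      obtain ⟨b, hb, hbx⟩ := List.mem_map.1 hx
      obtain ⟨l₂, l₃, rfl⟩ := List.append_of_mem hb
      exact ⟨[], x, l₂, b, l₃, by simp, hbx.symm⟩
    · obtain ⟨l₁, a, l₂, b, l₃, rfl, hab⟩ := List.exists_split_of_not_nodup_map f ht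
      exact ⟨x :: l₁, a, l₂, b, l₃, by simp, hab⟩

/-- The additive cohomological equation over a finite cycle is solvable as soon as the
right-hand side sums to zero. -/
theorem Equiv.Perm.IsCycleOn.exists_apply_eq_add {α G : Type*} [AddCommGroup G]
    {σ : Equiv.Perm α} {s : Finset α} (hσ : σ.IsCycleOn s) (g : α → G)
    (hg : ∑ x ∈ s, g x = 0) : ∃ ψ : α → G, ∀ x ∈ s, ψ (σ x) = ψ x + g x := by
  rcases s.eq_empty_or_nonempty with rfl | ⟨a, ha⟩
  · exact ⟨0, by simp⟩
  have hmem : ∀ k : ℕ, (σ ^ k) a ∈ s := fun k => by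
    induction k with
    | zero => simpa using ha
    | succ k ih =>
      rw [pow_succ', Equiv.Perm.mul_apply]
      exact hσ.apply_mem_iff.2 ih
  have hinj : ∀ {k l : ℕ}, k < s.card → l < s.card → (σ ^ k) a = (σ ^ l) a → k = l :=
    fun hk hl h => Nat.ModEq.eq_of_lt_of_lt ((hσ.pow_apply_eq_pow_apply ha).1 h) hk hl
  have hsum : ∑ k ∈ Finset.range s.card, g ((σ ^ k) a) = 0 := by
    rw [← hg]
    refine Finset.sum_bij (fun k _ => (σ ^ k) a) (fun k _ => hmem k)
      (fun k hk l hl h => hinj (Finset.mem_range.1 hk) (Finset.mem_range.1 hl) h)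
      (fun b hb => ?_) (fun _ _ => rfl)
    obtain ⟨n, hn, rfl⟩ := hσ.exists_pow_eq ha hb
    exact ⟨n, Finset.mem_range.2 hn, rfl⟩
  have hex : ∀ x, ∃ k : ℕ, x ∈ s → k < s.card ∧ (σ ^ k) a = x := fun x => by
    by_cases hx : x ∈ s
    · obtain ⟨n, hn, h⟩ := hσ.exists_pow_eq ha hx
      exact ⟨n, fun _ => ⟨hn, h⟩⟩
    · exact ⟨0, fun h => absurd h hx⟩
  choose k hk using hex
  refine ⟨fun x => ∑ j ∈ Finset.range (k x), g ((σ ^ j) a), fun x hx => ?_⟩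
  obtain ⟨hkx, hx'⟩ := hk x hx
  obtain ⟨hky, hy'⟩ := hk (σ x) (hσ.apply_mem_iff.2 hx)
  have hstep : (σ ^ (k x + 1)) a = σ x := by
    rw [pow_succ', Equiv.Perm.mul_apply, hx']
  have hval : ∑ j ∈ Finset.range (k x), g ((σ ^ j) a) + g x =
      ∑ j ∈ Finset.range (k x + 1), g ((σ ^ j) a) := by
    rw [Finset.sum_range_succ, hx']
  beta_reduce
  rw [hval]
  rcases Nat.lt_or_ge (k x + 1) s.card with hlt | hge
  · rw [hinj hky hlt (hy'.trans hstep.symm)]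
  · have hcard : k x + 1 = s.card := by omega
    have hzero : k (σ x) = 0 := by
      refine hinj hky (Finset.card_pos.2 ⟨a, ha⟩) ?_
      rw [hy', ← hstep, hcard, hσ.pow_card_apply ha, pow_zero, Equiv.Perm.one_apply]
    rw [hzero, hcard, hsum, Finset.sum_range_zero]

/-! ### Walks and sums along paths -/

namespace Quiv

variable {Q : Quiv}

/-- The list of arrows `l` can be traversed consecutively, starting at `i` and ending at `j`. -/
def IsWalk (Q : Quiv) : Q.V → List Q.A → Q.V → Prop
  | i, [], j => i = j
  | i, a :: l, j => Q.src a = i ∧ IsWalk Q (Q.tgt a) l j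

theorem isWalk_append {i j : Q.V} {l l' : List Q.A} :
    Q.IsWalk i (l ++ l') j ↔ ∃ k, Q.IsWalk i l k ∧ Q.IsWalk k l' j := by
  induction l generalizing i with
  | nil => simp [IsWalk]
  | cons a l ih => simp [IsWalk, ih, and_assoc]

theorem Path.isWalk_arrows {i j : Q.V} (p : Path Q i j) : Q.IsWalk i p.arrows j := by
  induction p with
  | nil i => rfl
  | cons a p ih => exact ⟨rfl, ih⟩

theorem IsWalk.exists_path {i j : Q.V} {l : List Q.A} (h : Q.IsWalk i l j) :
    ∃ p : Path Q i j, p.arrows = l := by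
  induction l generalizing i with
  | nil => cases h; exact ⟨.nil _, rfl⟩
  | cons a l ih =>
    obtain ⟨rfl, h⟩ := h
    obtain ⟨p, rfl⟩ := ih h
    exact ⟨.cons a p, rfl⟩

theorem Path.arrows_comp_s13 {i j k : Q.V} (p : Path Q i j) (q : Path Q j k) :
    (p.comp q).arrows = p.arrows ++ q.arrows := by
  induction p with
  | nil i => rfl
  | cons a p ih => simp [Path.comp, Path.arrows, ih]

theorem Path.arrows_cast_s13 {i i' j j' : Q.V} (hi : i = i') (hj : j = j') (p : Path Q i j) :
    (p.cast hi hj).arrows = p.arrows := by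
  cases hi; cases hj; rfl

theorem Path.content_cast {i i' j j' : Q.V} (hi : i = i') (hj : j = j') (p : Path Q i j) :
    (p.cast hi hj).content = p.content := by
  cases hi; cases hj; rfl

theorem Path.arrows_map_s13 {Q' : Quiv} (φ : Hom Q Q') {i j : Q.V} (p : Path Q i j) :
    (p.map φ).arrows = p.arrows.map φ.onA := by
  induction p with
  | nil i => rfl
  | cons a p ih =>
    simp [Path.map, Path.arrows_cast_s13, Path.arrows_comp_s13, Path.arrows, Path.single, ih]

theorem Path.arrows_heq {i i' j j' : Q.V} (hi : i = i') (hj : j = j') {p : Path Q i j}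
    {q : Path Q i' j'} (h : HEq p q) : p.arrows = q.arrows := by
  cases hi; cases hj; cases h; rfl

theorem Path.exists_heq_cons {i j : Q.V} (p : Path Q i j) {b : Q.A} {l : List Q.A}
    (h : p.arrows = b :: l) :
    Q.src b = i ∧ ∃ q : Path Q (Q.tgt b) j, q.arrows = l ∧ HEq p (Path.cons b q) := by
  cases p with
  | nil i => simp [Path.arrows] at h
  | cons a p =>
    simp only [Path.arrows, List.cons.injEq] at h
    obtain ⟨rfl, rfl⟩ := h
    exact ⟨rfl, p, rfl, HEq.rfl⟩

variable {G : Type*} [AddCommGroup G]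

/-- The sum of a cochain along a strict path. -/
def Path.sum (g : Q.A → G) {i j : Q.V} (p : Path Q i j) : G := (p.arrows.map g).sum

theorem Path.sum_comp (g : Q.A → G) {i j k : Q.V} (p : Path Q i j) (q : Path Q j k) :
    (p.comp q).sum g = p.sum g + q.sum g := by
  simp [Path.sum, Path.arrows_comp_s13]

theorem Path.sum_single (g : Q.A → G) (a : Q.A) : (Path.single a).sum g = g a := by
  simp [Path.sum, Path.single, Path.arrows]

theorem Path.sum_cast (g : Q.A → G) {i i' j j' : Q.V} (hi : i = i') (hj : j = j')
    (p : Path Q i j) : (p.cast hi hj).sum g = p.sum g := by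
  cases hi; cases hj; rfl

theorem Path.sum_neg (g : Q.A → G) {i j : Q.V} (p : Path Q i j) :
    p.sum (fun a => -g a) = -p.sum g := by
  rw [Path.sum, Path.sum]
  induction p.arrows with
  | nil => simp
  | cons a l ih => simp [ih, add_comm]

theorem Path.sum_add_sub (g : Q.A → G) (F : Q.V → G) {i j : Q.V} (p : Path Q i j) :
    (p.sum fun a => g a + F (Q.src a) - F (Q.tgt a)) = p.sum g + F i - F j := by
  induction p with
  | nil i => simp [Path.sum, Path.arrows]
  | cons a p ih =>
    simp only [Path.sum, Path.arrows, List.map_cons, List.sum_cons] at ih ⊢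
    rw [ih]
    abel

theorem Path.apply_eq {α : Type*} {F : Q.V → α} {i j : Q.V} (p : Path Q i j)
    (hF : ∀ a ∈ p.arrows, F (Q.src a) = F (Q.tgt a)) : F i = F j := by
  induction p with
  | nil i => rfl
  | cons a p ih =>
    simp only [Path.arrows, List.forall_mem_cons] at hF
    exact hF.1.trans (ih hF.2)

/-- The signed sum of a cochain along a weak path. -/
def WPath.sum (g : Q.A → G) : ∀ {i j : Q.V}, WPath Q i j → G
  | _, _, .nil _ => 0
  | _, _, .fwd a p => g a + p.sum g
  | _, _, .bwd a p => -g a + p.sum g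

theorem Path.sum_toWeak (g : Q.A → G) {i j : Q.V} (p : Path Q i j) :
    p.toWeak.sum g = p.sum g := by
  induction p with
  | nil i => rfl
  | cons a p ih => simp [Path.toWeak, WPath.sum, ih, Path.sum, Path.arrows]

theorem WPath.sum_comp (g : Q.A → G) {i j k : Q.V} (p : WPath Q i j) (q : WPath Q j k) :
    (p.comp q).sum g = p.sum g + q.sum g := by
  induction p with
  | nil i => simp [WPath.comp, WPath.sum]
  | fwd a p ih => simp [WPath.comp, WPath.sum, ih, add_assoc]
  | bwd a p ih => simp [WPath.comp, WPath.sum, ih, add_assoc]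

theorem WPath.sum_cast (g : Q.A → G) {i i' j j' : Q.V} (hi : i = i') (hj : j = j')
    (p : WPath Q i j) : (p.cast hi hj).sum g = p.sum g := by
  cases hi; cases hj; rfl

theorem WPath.sum_reverse (g : Q.A → G) {i j : Q.V} (p : WPath Q i j) :
    p.reverse.sum g = -p.sum g := by
  induction p with
  | nil i => simp [WPath.reverse, WPath.sum]
  | fwd a p ih => simp [WPath.reverse, WPath.sum, WPath.sum_comp, ih]
  | bwd a p ih => simp [WPath.reverse, WPath.sum, WPath.sum_comp, ih]

theorem WPath.sum_npow (g : Q.A → G) {i : Q.V} (c : WPath Q i i) (n : ℕ) :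
    (c.npow n).sum g = n • c.sum g := by
  induction n with
  | zero => simp [WPath.npow, WPath.sum]
  | succ n ih => simp [WPath.npow, WPath.sum_comp, ih, succ_nsmul']

theorem WPath.sum_zpow (g : Q.A → G) {i : Q.V} (c : WPath Q i i) (k : ℤ) :
    (c.zpow k).sum g = k • c.sum g := by
  unfold WPath.zpow
  split_ifs with h
  · rw [sum_npow, ← natCast_zsmul, Int.toNat_of_nonneg h]
  · rw [sum_npow, sum_reverse, ← natCast_zsmul, Int.toNat_of_nonneg (by omega), smul_neg,
      neg_smul, neg_neg]

theorem WEquiv.sum_eq {R : ∀ ⦃i j : Q.V⦄, WPath Q i j → WPath Q i j → Prop} (g : Q.A → G)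
    (hR : ∀ ⦃i j : Q.V⦄ (p q : WPath Q i j), R p q → p.sum g = q.sum g)
    {i j : Q.V} {p q : WPath Q i j} (h : WEquiv Q R p q) : p.sum g = q.sum g := by
  induction h with
  | base h => exact hR _ _ h
  | cancel_fwd a => simp [WPath.sum]
  | cancel_bwd a => simp [WPath.sum]
  | refl p => rfl
  | symm _ ih => exact ih.symm
  | trans _ _ ih₁ ih₂ => exact ih₁.trans ih₂
  | comp u v _ ih => simp [WPath.sum_comp, ih]

end Quiv

/-! ### Faces of the periodic quiver -/

theorem BraneTiling.arrows_wface_of_arrows_eq_cons (B : BraneTiling) {s : Bool} {a b : B.Q.A}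
    {l : List B.Q.A} (h : (B.wface s a).arrows = b :: l) :
    (B.wface s b).arrows = l ++ [a] := by
  obtain ⟨hb, q, rfl, hq⟩ := (B.wface s a).exists_heq_cons h
  rw [Path.arrows_heq rfl hb (B.rot s a b q hq), Path.arrows_comp_s13]
  rfl

namespace Periodic

variable {B : BraneTiling} (P : Periodic B)

theorem eq_of_src_eq {a b : P.tQ.A} (h : P.proj.onA a = P.proj.onA b)
    (hs : P.tQ.src a = P.tQ.src b) : a = b :=
  (P.liftSrc (P.proj.onA b) (P.tQ.src b) (P.proj.src_comm b).symm).unique ⟨h, hs⟩ ⟨rfl, rfl⟩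

theorem eq_of_tgt_eq {a b : P.tQ.A} (h : P.proj.onA a = P.proj.onA b)
    (ht : P.tQ.tgt a = P.tQ.tgt b) : a = b :=
  (P.liftTgt (P.proj.onA b) (P.tQ.tgt b) (P.proj.tgt_comm b).symm).unique ⟨h, ht⟩ ⟨rfl, rfl⟩

theorem finite_src_eq (i : P.tQ.V) : {a | P.tQ.src a = i}.Finite :=
  Set.Finite.of_finite_image (f := P.proj.onA) (Set.toFinite _)
    fun _ ha _ hb h => P.eq_of_src_eq h (ha.trans hb.symm)

theorem finite_tgt_eq (i : P.tQ.V) : {a | P.tQ.tgt a = i}.Finite :=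
  Set.Finite.of_finite_image (f := P.proj.onA) (Set.toFinite _)
    fun _ ha _ hb h => P.eq_of_tgt_eq h (ha.trans hb.symm)

theorem eq_of_isWalk {i j j' : P.tQ.V} {l l' : List P.tQ.A} (h : P.tQ.IsWalk i l j)
    (h' : P.tQ.IsWalk i l' j') (hl : l.map P.proj.onA = l'.map P.proj.onA) : l = l' := by
  induction l generalizing i l' with
  | nil => simpa [eq_comm] using hl
  | cons a l ih =>
    cases l' with
    | nil => simp at hl
    | cons b l' =>
      simp only [List.map_cons, List.cons.injEq] at hl
      obtain rfl := P.eq_of_src_eq hl.1 (h.1.trans h'.1.symm)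
      rw [ih h.2 h'.2 hl.2]

theorem arrows_faceCycle (s : Bool) (a : P.tQ.A) :
    (P.faceCycle s a).arrows = a :: (P.twface s a).arrows := rfl

theorem isWalk_twface_append (s : Bool) (a : P.tQ.A) :
    P.tQ.IsWalk (P.tQ.tgt a) ((P.twface s a).arrows ++ [a]) (P.tQ.tgt a) :=
  isWalk_append.2 ⟨_, (P.twface s a).isWalk_arrows, rfl, rfl⟩

/-- The arrow following `a` on the boundary of the face of sign `s` containing `a`. -/
def next (s : Bool) (a : P.tQ.A) : P.tQ.A :=
  ((P.twface s a).arrows ++ [a]).head (by simp)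

theorem next_eq_of_arrows_eq {s : Bool} {a b : P.tQ.A} {l : List P.tQ.A}
    (h : (P.twface s a).arrows ++ [a] = b :: l) : P.next s a = b := by
  simp [next, h]

theorem src_next (s : Bool) (a : P.tQ.A) : P.tQ.src (P.next s a) = P.tQ.tgt a := by
  have h := P.isWalk_twface_append s a
  obtain ⟨b, l, hl⟩ := List.exists_cons_of_ne_nil
    (show (P.twface s a).arrows ++ [a] ≠ [] by simp)
  rw [P.next_eq_of_arrows_eq hl]
  rw [hl] at h
  exact h.1

theorem arrows_faceCycle_next (s : Bool) (a : P.tQ.A) :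
    (P.faceCycle s (P.next s a)).arrows = (P.twface s a).arrows ++ [a] := by
  have hw := P.isWalk_twface_append s a
  have hm := P.map_arrows_twface s a
  rcases hl : (P.twface s a).arrows with _ | ⟨b, l⟩
  · rw [P.next_eq_of_arrows_eq (b := a) (l := []) (by simp [hl]), arrows_faceCycle, hl]
    rfl
  · rw [P.next_eq_of_arrows_eq (b := b) (l := l ++ [a]) (by simp [hl]), arrows_faceCycle]
    rw [hl] at hw hm
    refine congrArg (b :: ·) (P.eq_of_isWalk (P.twface s b).isWalk_arrows hw.2 ?_)
    rw [P.map_arrows_twface, B.arrows_wface_of_arrows_eq_cons (a := P.proj.onA a)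
      (l := l.map P.proj.onA) hm.symm]
    exact (List.map_append (f := P.proj.onA) (l₁ := l) (l₂ := [a])).symm

theorem arrows_faceCycle_of_split {s : Bool} {a b : P.tQ.A} {l₁ l₂ : List P.tQ.A}
    (h : (P.faceCycle s a).arrows = l₁ ++ b :: l₂) :
    (P.faceCycle s b).arrows = b :: l₂ ++ l₁ := by
  induction l₁ generalizing a l₂ with
  | nil =>
    obtain rfl : a = b := by
      have := (P.arrows_faceCycle s a).symm.trans h
      simp_all
    simpa using h
  | cons x l₁ ih =>
    obtain ⟨rfl, hl⟩ := List.cons.inj ((P.arrows_faceCycle s a).symm.trans h)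
    have := ih (a := P.next s a) (l₂ := l₂ ++ [a]) (by rw [arrows_faceCycle_next, hl]; simp)
    simpa using this

theorem mem_faceCycle_self (s : Bool) (a : P.tQ.A) : a ∈ (P.faceCycle s a).arrows := by
  simp [arrows_faceCycle]

theorem mem_faceCycle_iff {s : Bool} {a b : P.tQ.A} (h : b ∈ (P.faceCycle s a).arrows)
    (x : P.tQ.A) : x ∈ (P.faceCycle s b).arrows ↔ x ∈ (P.faceCycle s a).arrows := by
  obtain ⟨l₁, l₂, hl⟩ := List.append_of_mem h
  rw [P.arrows_faceCycle_of_split hl, hl]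
  simp only [List.cons_append, List.mem_cons, List.mem_append]
  tauto

theorem next_bijective (s : Bool) : Function.Bijective (P.next s) := by
  constructor
  · intro a a' h
    have := P.arrows_faceCycle_next s a
    rw [h, arrows_faceCycle_next] at this
    simpa using (congrArg List.getLast? this).symm
  · intro b
    rcases List.eq_nil_or_concat (P.twface s b).arrows with h | ⟨l, a, h⟩
    · exact ⟨b, P.next_eq_of_arrows_eq (l := []) (by simp [h])⟩
    · refine ⟨a, P.next_eq_of_arrows_eq (l := l ++ [a]) ?_⟩
      have := P.arrows_faceCycle_of_split (s := s) (a := b) (b := a) (l₁ := b :: l) (l₂ := [])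
        (by rw [arrows_faceCycle, h]; simp)
      rw [arrows_faceCycle] at this
      simp only [List.cons_append, List.nil_append, List.cons.injEq, true_and] at this
      rw [this, List.cons_append]

/-- The permutation of the arrows that rotates all faces of sign `s`. -/
def nextPerm (s : Bool) : Equiv.Perm P.tQ.A := Equiv.ofBijective _ (P.next_bijective s)

theorem nextPerm_apply (s : Bool) (a : P.tQ.A) : P.nextPerm s a = P.next s a := rfl

theorem tgt_nextPerm_symm (s : Bool) (a : P.tQ.A) :
    P.tQ.tgt ((P.nextPerm s).symm a) = P.tQ.src a := by
  rw [← P.src_next s, ← nextPerm_apply, Equiv.apply_symm_apply]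

theorem next_eq_of_split {s : Bool} {a x y : P.tQ.A} {l₁ l₂ : List P.tQ.A}
    (h : (P.faceCycle s a).arrows = l₁ ++ x :: y :: l₂) : P.next s x = y := by
  have := P.arrows_faceCycle_of_split h
  rw [arrows_faceCycle, List.cons_append, List.cons.injEq] at this
  exact P.next_eq_of_arrows_eq (l := l₂ ++ l₁ ++ [x]) (by rw [this.2]; simp)

theorem next_eq_of_split_last {s : Bool} {a x : P.tQ.A} {l₁ : List P.tQ.A}
    (h : (P.faceCycle s a).arrows = l₁ ++ [x]) : P.next s x = a := by
  have h' := P.arrows_faceCycle_of_split h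
  rw [arrows_faceCycle, List.cons_append, List.cons.injEq, List.nil_append] at h'
  rw [arrows_faceCycle] at h
  exact P.next_eq_of_arrows_eq (l := (P.twface s a).arrows) (by rw [h'.2, h])

section Cochains

variable {G : Type*} [AddCommGroup G]

theorem sum_faceCycle_sub_next (s : Bool) (ψ : P.tQ.A → G) (a : P.tQ.A) :
    (P.faceCycle s a).sum (fun x => ψ x - ψ (P.next s x)) = 0 := by
  have key : ∀ (l₂ l₁ : List P.tQ.A) (x : P.tQ.A),
      (P.faceCycle s a).arrows = l₁ ++ x :: l₂ →
        ((x :: l₂).map fun y => ψ y - ψ (P.next s y)).sum = ψ x - ψ a := by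
    intro l₂
    induction l₂ with
    | nil =>
      intro l₁ x h
      simp [P.next_eq_of_split_last h]
    | cons y l₃ ih =>
      intro l₁ x h
      rw [List.map_cons, List.sum_cons, ih (l₁ ++ [x]) y (by simp [h]), P.next_eq_of_split h]
      abel
  rw [Path.sum, arrows_faceCycle, key _ [] a (P.arrows_faceCycle s a), sub_self]

theorem eq_of_mem_faceCycle {α : Type*} {s : Bool} {φ : P.tQ.A → α}
    (hφ : ∀ a, φ (P.next s a) = φ a) {a b : P.tQ.A} (hb : b ∈ (P.faceCycle s a).arrows) :
    φ b = φ a := by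
  obtain ⟨l₁, l₂, hl⟩ := List.append_of_mem hb
  clear hb
  induction l₁ generalizing a l₂ with
  | nil =>
    rw [arrows_faceCycle, List.nil_append, List.cons.injEq] at hl
    rw [hl.1]
  | cons x l₁ ih =>
    rw [arrows_faceCycle, List.cons_append, List.cons.injEq] at hl
    rw [ih (a := P.next s a) (l₂ ++ [a]) (by rw [arrows_faceCycle_next, hl.2]; simp), hφ]

theorem sum_eq_of_wkEquiv {g : P.tQ.A → G} {κ : G}
    (hg : ∀ s a, (P.faceCycle s a).sum g = κ) {i j : P.tQ.V} {u u' : WPath P.tQ i j}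
    (h : P.WkEquiv u u') : u.sum g = u'.sum g := by
  refine WEquiv.sum_eq g ?_ h
  rintro _ _ _ _ ⟨s, t, a, b, h⟩
  rw [WPath.sum_cast, Path.sum_toWeak, Path.sum_toWeak, hg, hg]

end Cochains

/-- The indicator cochain of a set of arrows. -/
def indicator (S : Set P.tQ.A) (a : P.tQ.A) : ℤ := if a ∈ S then 1 else 0

variable {P}

theorem sum_indicator {i j : P.tQ.V} (p : Path P.tQ i j) (S : Set P.tQ.A) :
    p.sum (P.indicator S) = p.arrows.countP (fun x => decide (x ∈ S)) := by
  rw [Path.sum]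
  induction p.arrows with
  | nil => rfl
  | cons a l ih =>
    rw [List.map_cons, List.sum_cons, ih, List.countP_cons, indicator]
    by_cases h : a ∈ S <;> simp [h, add_comm]

theorem isMatching_iff {S : Set P.tQ.A} :
    P.IsMatching S ↔ ∀ s a, (P.faceCycle s a).sum (P.indicator S) = 1 := by
  simp only [IsMatching, sum_indicator, Nat.cast_eq_one]

theorem IsMatching.eq_of_mem {S : Set P.tQ.A} (hS : P.IsMatching S) {s : Bool}
    {a x y : P.tQ.A} (hx : x ∈ (P.faceCycle s a).arrows) (hxS : x ∈ S)
    (hy : y ∈ (P.faceCycle s a).arrows) (hyS : y ∈ S) : x = y :=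
  List.eq_of_countP_eq_one (hS s a) hx (decide_eq_true hxS) hy (decide_eq_true hyS)

theorem IsMatching.exists_mem {S : Set P.tQ.A} (hS : P.IsMatching S) (s : Bool)
    (a : P.tQ.A) : ∃ x ∈ (P.faceCycle s a).arrows, x ∈ S := by
  have h := List.countP_pos_iff.1 ((hS s a).symm ▸ Nat.one_pos)
  simpa using h

theorem isMatching_preimage {M : Set B.Q.A} (hM : B.IsMatching M) :
    P.IsMatching (P.proj.onA ⁻¹' M) := by
  intro s a
  rw [← hM s (P.proj.onA a), BraneTiling.cycleArrows, BraneTiling.faceCycle, Path.arrows,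
    ← P.map_arrows_twface, arrows_faceCycle, ← List.map_cons, List.countP_map]
  rfl

theorem exists_isMatching_mem (hB : B.NonDegenerate) (a : P.tQ.A) :
    ∃ M, P.IsMatching M ∧ a ∈ M := by
  obtain ⟨M, hM, ha⟩ := hB (P.proj.onA a)
  exact ⟨_, isMatching_preimage hM, ha⟩

/-- A function constant on all faces of sign `s` has the same sum over `I \ J` as over `J \ I`,
for perfect matchings `I` and `J` that differ by a finite set. -/
theorem IsMatching.sum_sdiff_eq {G : Type*} [AddCommGroup G] {I J : Set P.tQ.A}
    (hI : P.IsMatching I) (hJ : P.IsMatching J) (hIJ : (I \ J).Finite) (hJI : (J \ I).Finite)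
    {s : Bool} {φ : P.tQ.A → G} (hφ : ∀ a, φ (P.next s a) = φ a) :
    ∑ a ∈ hIJ.toFinset, φ a = ∑ a ∈ hJI.toFinset, φ a := by
  choose e he heJ using hJ.exists_mem s
  refine Finset.sum_bij (fun a _ => e a) ?_ ?_ ?_ ?_
  · intro a ha
    rw [Set.Finite.mem_toFinset] at ha ⊢
    exact ⟨heJ a, fun h => ha.2 <|
      (hI.eq_of_mem (he a) h (P.mem_faceCycle_self s a) ha.1) ▸ heJ a⟩
  · intro a ha b hb hab
    rw [Set.Finite.mem_toFinset] at ha hb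
    refine hI.eq_of_mem ((P.mem_faceCycle_iff (he a) a).2 (P.mem_faceCycle_self s a)) ha.1 ?_ hb.1
    rw [hab]
    exact (P.mem_faceCycle_iff (he b) b).2 (P.mem_faceCycle_self s b)
  · intro b hb
    rw [Set.Finite.mem_toFinset] at hb
    obtain ⟨a, ha, haI⟩ := hI.exists_mem s b
    have hba := (P.mem_faceCycle_iff ha b).2 (P.mem_faceCycle_self s b)
    refine ⟨a, ?_, hJ.eq_of_mem (he a) (heJ a) hba hb.1⟩
    rw [Set.Finite.mem_toFinset]
    exact ⟨haI, fun h => hb.2 <|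
      (hJ.eq_of_mem ha h (P.mem_faceCycle_self s b) hb.1) ▸ haI⟩
  · intro a _
    exact (P.eq_of_mem_faceCycle hφ (he a)).symm

end Periodic

/-! ### Connectedness of vertex links -/

namespace Periodic

variable {B : BraneTiling} (P : Periodic B)

/-- The permutation of the arrows that rotates the arrows leaving a vertex around it. -/
def linkPerm : Equiv.Perm P.tQ.A := (P.nextPerm true).symm.trans (P.nextPerm false)

theorem linkPerm_next_true (a : P.tQ.A) : P.linkPerm (P.next true a) = P.next false a := by
  rw [linkPerm, Equiv.trans_apply, ← nextPerm_apply, Equiv.symm_apply_apply, nextPerm_apply]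

theorem src_linkPerm (a : P.tQ.A) : P.tQ.src (P.linkPerm a) = P.tQ.src a := by
  rw [linkPerm, Equiv.trans_apply, nextPerm_apply, src_next, tgt_nextPerm_symm]

/-- Two paths of `Q`, given by their lists of arrows, are both trivial or start with arrows
in the same component of the link of a vertex. -/
def HeadsLinked (l l' : List B.Q.A) : Prop :=
  (l = [] ∧ l' = []) ∨ ∃ b l₁ b' l₁', l = b :: l₁ ∧ l' = b' :: l₁' ∧
    ∀ x y, P.proj.onA x = b → P.proj.onA y = b' → P.tQ.src x = P.tQ.src y →
      P.linkPerm.SameCycle x y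

variable {P}

theorem HeadsLinked.refl (l : List B.Q.A) : P.HeadsLinked l l := by
  rcases l with _ | ⟨b, l⟩
  · exact Or.inl ⟨rfl, rfl⟩
  · refine Or.inr ⟨b, l, b, l, rfl, rfl, fun x y hx hy h => ?_⟩
    rw [P.eq_of_src_eq (hx.trans hy.symm) h]

theorem HeadsLinked.symm {l l' : List B.Q.A} (h : P.HeadsLinked l l') : P.HeadsLinked l' l := by
  rcases h with ⟨rfl, rfl⟩ | ⟨b, l₁, b', l₁', rfl, rfl, h⟩
  · exact Or.inl ⟨rfl, rfl⟩
  · exact Or.inr ⟨b', l₁', b, l₁, rfl, rfl, fun x y hx hy hxy => (h y x hy hx hxy.symm).symm⟩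

theorem HeadsLinked.trans {i j : B.Q.V} {p q r : Path B.Q i j}
    (hpq : P.HeadsLinked p.arrows q.arrows) (hqr : P.HeadsLinked q.arrows r.arrows) :
    P.HeadsLinked p.arrows r.arrows := by
  rcases hpq with ⟨hp, hq⟩ | ⟨b, l, c, m, hp, hq, h⟩
  · rw [hq] at hqr
    rwa [hp]
  rcases hqr with ⟨hq', hr⟩ | ⟨c', m', d, n, hq', hr, h'⟩
  · simp [hq] at hq'
  obtain ⟨rfl, rfl⟩ := List.cons.inj (hq.symm.trans hq')
  refine Or.inr ⟨b, l, d, n, hp, hr, fun x y hx hy hxy => ?_⟩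
  have hc : P.proj.onV (P.tQ.src x) = B.Q.src c := by
    rw [← P.proj.src_comm, hx, (q.exists_heq_cons hq).1, (p.exists_heq_cons hp).1]
  obtain ⟨z, ⟨hz, hzx⟩, -⟩ := P.liftSrc c (P.tQ.src x) hc
  exact (h x z hx hz hzx.symm).trans (h' z y hz hy (hzx.trans hxy))

theorem HeadsLinked.append {l l' : List B.Q.A} (u v : List B.Q.A) (h : P.HeadsLinked l l') :
    P.HeadsLinked (u ++ (l ++ v)) (u ++ (l' ++ v)) := by
  rcases u with _ | ⟨b, u⟩
  · rcases h with ⟨rfl, rfl⟩ | ⟨b, l₁, b', l₁', rfl, rfl, h⟩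
    · exact .refl _
    · exact Or.inr ⟨b, _, b', _, rfl, rfl, h⟩
  · refine Or.inr ⟨b, _, b, _, rfl, rfl, fun x y hx hy h => ?_⟩
    rw [P.eq_of_src_eq (hx.trans hy.symm) h]

theorem _root_.BraneTiling.arrows_wface_eq_nil (hB : B.NonDegenerate) {c : B.Q.A} {s t : Bool}
    (h : (B.wface s c).arrows = []) : (B.wface t c).arrows = [] := by
  by_contra hne
  obtain ⟨b, l, hb⟩ := List.exists_cons_of_ne_nil hne
  obtain ⟨M, hM, hbM⟩ := hB b
  have hs := hM s c
  have ht := hM t c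
  simp only [BraneTiling.cycleArrows, BraneTiling.faceCycle, Path.arrows, h, hb,
    List.countP_cons, List.countP_nil] at hs ht
  simp only [hbM, decide_true, if_true] at ht
  omega

theorem headsLinked_wface (hB : B.NonDegenerate) (c : B.Q.A) :
    P.HeadsLinked (B.wface true c).arrows (B.wface false c).arrows := by
  rcases ht : (B.wface true c).arrows with _ | ⟨b, l⟩
  · rw [B.arrows_wface_eq_nil hB ht]
    exact .refl _
  rcases hf : (B.wface false c).arrows with _ | ⟨b', l'⟩
  · rw [B.arrows_wface_eq_nil hB hf] at ht
    simp at ht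
  have next_eq : ∀ {s : Bool} {b l} (y x : P.tQ.A), (B.wface s c).arrows = b :: l →
      P.proj.onA y = c → P.proj.onA x = b → P.tQ.tgt y = P.tQ.src x → P.next s y = x := by
    intro s b l y x h hy hx hyx
    have hm := P.map_arrows_twface s y
    rw [hy, h, List.map_eq_cons_iff] at hm
    obtain ⟨z, m, hz, hzb, -⟩ := hm
    have hnz : P.next s y = z := P.next_eq_of_arrows_eq (l := m ++ [y]) (by rw [hz]; rfl)
    rw [hnz]
    refine P.eq_of_src_eq (hzb.trans hx.symm) ?_
    rw [← hyx, ← P.src_next s, hnz]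
  refine Or.inr ⟨b, l, b', l', rfl, rfl, fun x y hx hy hxy => ?_⟩
  have hc : P.proj.onV (P.tQ.src x) = B.Q.tgt c := by
    rw [← P.proj.src_comm, hx, ((B.wface true c).exists_heq_cons ht).1]
  obtain ⟨z, ⟨hz, hzx⟩, -⟩ := P.liftTgt c (P.tQ.src x) hc
  refine ⟨1, ?_⟩
  rw [zpow_one, ← next_eq z x ht hz hx hzx, linkPerm_next_true,
    next_eq z y hf hz hy (hzx.trans hxy)]

theorem headsLinked_of_sEquiv (hB : B.NonDegenerate) {i j : B.Q.V} {p q : Path B.Q i j}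
    (h : B.SEquiv p q) : P.HeadsLinked p.arrows q.arrows := by
  induction h with
  | base h => cases h; exact headsLinked_wface hB _
  | refl p => exact .refl _
  | symm _ ih => exact ih.symm
  | trans _ _ ih₁ ih₂ => exact ih₁.trans ih₂
  | comp u v _ ih => simpa only [Path.arrows_comp_s13] using ih.append _ _

theorem sameCycle_linkPerm (hB : B.NonDegenerate) (hc : B.Consistent1) {x y : P.tQ.A}
    (h : P.tQ.src x = P.tQ.src y) : P.linkPerm.SameCycle x y := by
  have hxy : B.Q.src (P.proj.onA y) = B.Q.src (P.proj.onA x) := by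
    rw [P.proj.src_comm, P.proj.src_comm, h]
  let q := (B.faceCycle true (P.proj.onA y)).cast hxy hxy
  have hq : q.arrows = (B.faceCycle true (P.proj.onA y)).arrows := Path.arrows_cast_s13 ..
  have hw : B.wtP (B.faceCycle true (P.proj.onA x)) = B.wtP q := by
    rw [BraneTiling.wtP, BraneTiling.wtP, Path.content_cast]
    exact (Submodule.Quotient.eq _).2 (Submodule.subset_span ⟨_, _, _, _, rfl⟩)
  obtain ⟨_, hs⟩ := (hc _ _ _ _ _).2 hw
  rcases headsLinked_of_sEquiv (P := P) hB hs with ⟨hn, -⟩ | ⟨b, l, b', l', hb, hb', H⟩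
  · simp [Path.arrows_cast_s13, BraneTiling.faceCycle, Path.arrows] at hn
  · rw [Path.arrows_cast_s13, BraneTiling.faceCycle, Path.arrows, List.cons.injEq] at hb
    rw [hq, BraneTiling.faceCycle, Path.arrows, List.cons.injEq] at hb'
    exact H x y hb.1 hb'.1 h

theorem isCycleOn_linkPerm (hB : B.NonDegenerate) (hc : B.Consistent1) (i : P.tQ.V) :
    P.linkPerm.IsCycleOn (P.finite_src_eq i).toFinset := by
  rw [Set.Finite.coe_toFinset]
  refine ⟨⟨fun a ha => (P.src_linkPerm a).trans ha, P.linkPerm.injective.injOn, fun a ha =>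
    ⟨P.linkPerm.symm a, ?_, P.linkPerm.apply_symm_apply a⟩⟩,
    fun a ha b hb => sameCycle_linkPerm hB hc (ha.trans hb.symm)⟩
  change P.tQ.src _ = i
  rw [← P.src_linkPerm, P.linkPerm.apply_symm_apply]
  exact ha

end Periodic

/-! ### Comparison of congruent perfect matchings -/

namespace DeltaData

variable {B : BraneTiling} {P : Periodic B} {i0 : P.tQ.V} (D : DeltaData B P i0)

section Cochains

variable {G : Type*} [AddCommGroup G]

theorem sum_omega {g : P.tQ.A → G} {κ : G} (hg : ∀ s a, (P.faceCycle s a).sum g = κ) :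
    D.omega.sum g = κ := by
  obtain ⟨s, a, h, he⟩ := D.omega_isFace
  rw [he, Path.sum_cast, hg]

theorem sum_eq_cl {g : P.tQ.A → G} {κ : G} (hg : ∀ s a, (P.faceCycle s a).sum g = κ)
    {j : P.tQ.V} (u : WPath P.tQ i0 j) : u.sum g = D.cl u • κ + (D.v j).sum g := by
  rw [P.sum_eq_of_wkEquiv hg (D.cl_spec j u), WPath.sum_comp, WPath.sum_zpow, Path.sum_toWeak,
    Path.sum_toWeak, D.sum_omega hg]

/-- A cochain which is balanced at every vertex splits as the sum of a function constant on
positive faces and a function constant on negative faces. -/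
theorem exists_eq_add (D : DeltaData B P i0) (hB : B.NonDegenerate) (hc : B.Consistent1)
    (e : P.tQ.A → G)
    (he : ∀ i, ∑ a ∈ (P.finite_src_eq i).toFinset, e a =
      ∑ a ∈ (P.finite_tgt_eq i).toFinset, e a) :
    ∃ φ φ' : P.tQ.A → G, (∀ a, φ (P.next true a) = φ a) ∧
      (∀ a, φ' (P.next false a) = φ' a) ∧ ∀ a, e a = φ a + φ' a := by
  have hψ : ∃ ψ : P.tQ.A → G, ∀ a,
      ψ (P.next false a) = ψ (P.next true a) + (e (P.next false a) - e a) := by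
    have hi : ∀ i, ∃ ψ : P.tQ.A → G, ∀ x ∈ (P.finite_src_eq i).toFinset,
        ψ (P.linkPerm x) = ψ x + (e (P.linkPerm x) - e ((P.nextPerm true).symm x)) := by
      intro i
      refine (Periodic.isCycleOn_linkPerm hB hc i).exists_apply_eq_add _ ?_
      rw [Finset.sum_sub_distrib, sub_eq_zero]
      trans ∑ a ∈ (P.finite_src_eq i).toFinset, e a
      · exact Finset.sum_equiv P.linkPerm (by simp [P.src_linkPerm]) (fun _ _ => rfl)
      · rw [he]
        exact (Finset.sum_equiv (P.nextPerm true).symm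
          (by simp [P.tgt_nextPerm_symm]) (fun _ _ => rfl)).symm
    choose ψ hψ using hi
    refine ⟨fun a => ψ (P.tQ.src a) a, fun a => ?_⟩
    have := hψ (P.tQ.tgt a) (P.next true a) (by simp [P.src_next])
    rw [P.linkPerm_next_true, ← P.nextPerm_apply true, Equiv.symm_apply_apply] at this
    simpa only [P.src_next, P.nextPerm_apply] using this
  obtain ⟨ψ, hψ⟩ := hψ
  let m : P.tQ.A → G := fun a => ψ a - ψ (P.next true a)
  have hm : ∀ a, m a = -((e a - ψ a) - (e (P.next false a) - ψ (P.next false a))) := by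
    intro a
    simp only [m, hψ]
    abel
  have hsum : ∀ s a, (P.faceCycle s a).sum m = 0 := by
    rintro (_ | _) a
    · have h := P.sum_faceCycle_sub_next false (fun x => e x - ψ x) a
      rw [show m = fun x => -((e x - ψ x) - (e (P.next false x) - ψ (P.next false x))) from
        funext hm, Path.sum_neg, neg_eq_zero]
      exact h
    · exact P.sum_faceCycle_sub_next true ψ a
  obtain ⟨t, ht⟩ : ∃ t : P.tQ.V → G, ∀ a,
      t (P.tQ.tgt a) = t (P.tQ.src a) + (ψ a - ψ (P.next true a)) := by
    refine ⟨fun i => (D.v i).sum m, fun a => ?_⟩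
    have h := D.sum_eq_cl hsum ((D.v (P.tQ.src a)).comp (Path.single a)).toWeak
    rw [Path.sum_toWeak, Path.sum_comp, Path.sum_single, smul_zero, zero_add] at h
    exact h.symm
  clear hsum hm m he
  refine ⟨fun a => ψ a + t (P.tQ.src a), fun a => e a - ψ a - t (P.tQ.src a),
    fun a => ?_, fun a => ?_, fun a => ?_⟩
  · simp only [P.src_next, ht]
    abel
  · simp only [P.src_next, ht, hψ]
    abel
  · dsimp only
    abel

end Cochains

/-- The difference of two perfect matchings that differ by a finite set is the coboundary of a
finitely supported function. -/
theorem exists_finsupp_sub_eq (D : DeltaData B P i0) (hB : B.NonDegenerate)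
    (hc : B.Consistent1) {I J : Set P.tQ.A}
    (hI : P.IsMatching I) (hJ : P.IsMatching J) (hIJ : (symmDiff I J).Finite) :
    ∃ H : P.tQ.V →₀ ℤ, ∀ a,
      H (P.tQ.src a) - H (P.tQ.tgt a) = P.indicator I a - P.indicator J a := by
  have h₁ : (I \ J).Finite := hIJ.subset fun _ h => Or.inl h
  have h₂ : (J \ I).Finite := hIJ.subset fun _ h => Or.inr h
  let δ : P.tQ.V → P.tQ.A →₀ ℤ := fun i =>
    ∑ a ∈ (P.finite_src_eq i).toFinset, Finsupp.single a 1 -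
      ∑ a ∈ (P.finite_tgt_eq i).toFinset, Finsupp.single a 1
  let N := Submodule.span ℤ (Set.range δ)
  obtain ⟨φ, φ', hφ, hφ', h⟩ := D.exists_eq_add hB hc (fun a => N.mkQ (Finsupp.single a 1))
    fun i => by
      rw [← map_sum, ← map_sum, ← sub_eq_zero, ← map_sub]
      exact (Submodule.Quotient.mk_eq_zero N).2 (Submodule.subset_span ⟨i, rfl⟩)
  have hZ : (∑ a ∈ h₁.toFinset, Finsupp.single a (1 : ℤ) -
      ∑ a ∈ h₂.toFinset, Finsupp.single a 1) ∈ N := by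
    rw [← Submodule.Quotient.mk_eq_zero N, ← Submodule.mkQ_apply, map_sub, map_sum, map_sum,
      sub_eq_zero]
    simp only [h, Finset.sum_add_distrib]
    rw [hI.sum_sdiff_eq hJ h₁ h₂ hφ, hI.sum_sdiff_eq hJ h₁ h₂ hφ']
  obtain ⟨H, hH⟩ := Finsupp.mem_span_range_iff_exists_finsupp.1 hZ
  have hsum : ∀ {s : Set P.tQ.A} (hs : s.Finite) (a : P.tQ.A),
      (∑ x ∈ hs.toFinset, Finsupp.single x (1 : ℤ)) a = if a ∈ s then 1 else 0 := by
    intro s hs a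
    simp [Finsupp.finsetSum_apply, Finsupp.single_apply]
  refine ⟨H, fun a => ?_⟩
  have ha := DFunLike.congr_fun hH a
  rw [Finsupp.sum_apply] at ha
  simp only [Finsupp.smul_apply, Finsupp.sub_apply, δ, hsum, smul_eq_mul, mul_sub,
    Finsupp.sum_sub] at ha
  simp only [Set.mem_ofPred_eq, mul_ite, mul_one, mul_zero, Finsupp.sum_ite_eq] at ha
  have hH' : ∀ i, (if H i = 0 then 0 else H i) = H i := by grind
  by_cases h₁ : a ∈ I <;> by_cases h₂ : a ∈ J <;>
    simpa [Periodic.indicator, h₁, h₂, hH'] using ha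

end DeltaData

/-! ### Shortest paths -/

namespace Periodic

variable {B : BraneTiling} {P : Periodic B}

theorem Shortest.sum_indicator_le {i j : P.tQ.V} {u : Path P.tQ i j} (hu : P.Shortest u)
    {M : Set P.tQ.A} (hM : P.IsMatching M) (p : Path P.tQ i j) :
    u.sum (P.indicator M) ≤ p.sum (P.indicator M) := by
  obtain ⟨s, a, h, k, hk⟩ := hu p
  have hk := P.sum_eq_of_wkEquiv (isMatching_iff.1 hM) hk
  rw [Path.sum_toWeak, WPath.sum_comp, WPath.sum_cast, WPath.sum_npow, Path.sum_toWeak,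
    isMatching_iff.1 hM, Path.sum_toWeak, nsmul_one] at hk
  omega

theorem Shortest.nodup_map_tgt (hB : B.NonDegenerate) {i j : P.tQ.V} {u : Path P.tQ i j}
    (hu : P.Shortest u) : (u.arrows.map P.tQ.tgt).Nodup := by
  by_contra h
  obtain ⟨l₁, a, l₂, b, l₃, hl, hab⟩ := List.exists_split_of_not_nodup_map _ h
  have hw := u.isWalk_arrows
  simp only [hl, List.append_assoc, List.cons_append, isWalk_append, IsWalk] at hw
  obtain ⟨k, h₁, ha, -, -, -, h₃⟩ := hw
  obtain ⟨p, hp⟩ := (isWalk_append.2 ⟨k, h₁, ha, hab ▸ h₃⟩ :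
    P.tQ.IsWalk i (l₁ ++ a :: l₃) j).exists_path
  obtain ⟨M, hM, hb⟩ := exists_isMatching_mem hB b
  have hle := hu.sum_indicator_le hM p
  rw [sum_indicator, sum_indicator, hl, hp, Nat.cast_le] at hle
  simp only [List.countP_append, List.countP_cons, hb, decide_true, if_true] at hle
  omega

/-- A set of vertices that is preserved by extending shortest paths from `i` is infinite as soon
as it contains the endpoint of one such path. -/
theorem infinite_of_shortest_extension (hB : B.NonDegenerate) (hc : P.Consistent2)
    {i j : P.tQ.V} {u : Path P.tQ i j} (hu : P.Shortest u) {K : Set P.tQ.V} (hj : j ∈ K)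
    (hK : ∀ (a : P.tQ.A) (w : Path P.tQ i (P.tQ.src a)), P.Shortest w →
      P.Shortest (w.comp (Path.single a)) → P.tQ.src a ∈ K → P.tQ.tgt a ∈ K) :
    K.Infinite := by
  have hext : ∀ n : ℕ, ∃ (k : P.tQ.V) (w : Path P.tQ i k) (l : List P.tQ.A),
      P.Shortest w ∧ k ∈ K ∧ w.arrows = u.arrows ++ l ∧ l.length = n ∧
        ∀ x ∈ l, P.tQ.tgt x ∈ K := by
    intro n
    induction n with
    | zero => exact ⟨j, u, [], hu, hj, by simp, rfl, by simp⟩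
    | succ n ih =>
      obtain ⟨k, w, l, hw, hk, hl, hn, hlK⟩ := ih
      obtain ⟨a, rfl, ha⟩ := (hc i k w hw).1
      have ht := hK a w hw ha hk
      refine ⟨_, _, l ++ [a], ha, ht, ?_, by simp [hn], ?_⟩
      · rw [Path.arrows_comp_s13, hl, List.append_assoc]
        rfl
      · intro x hx
        rcases List.mem_append.1 hx with hx | hx
        · exact hlK x hx
        · rwa [List.mem_singleton.1 hx]
  intro hfin
  obtain ⟨k, w, l, hw, -, hl, hn, hlK⟩ := hext (hfin.toFinset.card + 1)
  have hnd := hw.nodup_map_tgt hB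
  rw [hl, List.map_append] at hnd
  have hnd := hnd.of_append_right
  have hsub : (l.map P.tQ.tgt).toFinset ⊆ hfin.toFinset := by
    intro x hx
    obtain ⟨y, hy, rfl⟩ := List.mem_map.1 (List.mem_toFinset.1 hx)
    exact hfin.mem_toFinset.2 (hlK y hy)
  have hcard := Finset.card_le_card hsub
  rw [List.toFinset_card_of_nodup hnd, List.length_map] at hcard
  omega

theorem indicator_setOf_one_le {g : P.tQ.A → ℤ} (hg : ∀ a, 0 ≤ g a)
    (hsum : ∀ s a, (P.faceCycle s a).sum g = 1) : P.indicator {a | 1 ≤ g a} = g := by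
  funext a
  have h : g a ≤ (P.faceCycle true a).sum g :=
    List.single_le_sum (by simpa using fun b _ => hg b) _
      (List.mem_map_of_mem (P.mem_faceCycle_self true a))
  rw [hsum] at h
  have := hg a
  simp only [indicator, Set.mem_ofPred_eq]
  split_ifs <;> omega

theorem IsMatching.not_mem_of_mem_twface {I : Set P.tQ.A} (hI : P.IsMatching I) {s : Bool}
    {a b : P.tQ.A} (ha : a ∈ I) (hb : b ∈ (P.twface s a).arrows) : b ∉ I := by
  have h := hI s a
  rw [arrows_faceCycle, List.countP_cons_of_pos (by simpa using ha), Nat.add_eq_right,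
    List.countP_eq_zero] at h
  simpa using h b hb

end Periodic

/-! ### Heights of ideals -/

namespace DeltaData

variable {B : BraneTiling} {P : Periodic B} {i0 : P.tQ.V} (D : DeltaData B P i0)

/-- The exponent `k` for which `a v_i ∼ ω^k v_j`, where `a : i → j`. -/
def step (a : P.tQ.A) : ℤ := D.cl ((D.v (P.tQ.src a)).comp (Path.single a)).toWeak

variable {M : Set P.tQ.A}

theorem step_eq (hM : P.IsMatching M) (a : P.tQ.A) :
    D.step a = P.indicator M a + (D.v (P.tQ.src a)).sum (P.indicator M) -
      (D.v (P.tQ.tgt a)).sum (P.indicator M) := by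
  have h := D.sum_eq_cl (Periodic.isMatching_iff.1 hM)
    ((D.v (P.tQ.src a)).comp (Path.single a)).toWeak
  rw [Path.sum_toWeak, Path.sum_comp, Path.sum_single, smul_eq_mul, mul_one] at h
  rw [step]
  omega

theorem sum_step (hM : P.IsMatching M) {i j : P.tQ.V} (w : Path P.tQ i j) :
    w.sum D.step = w.sum (P.indicator M) + (D.v i).sum (P.indicator M) -
      (D.v j).sum (P.indicator M) := by
  rw [← Path.sum_add_sub _ fun i => (D.v i).sum (P.indicator M)]
  exact congrArg (fun g => w.sum g) (funext (D.step_eq hM))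

theorem sum_step_faceCycle (hM : P.IsMatching M) (s : Bool) (a : P.tQ.A) :
    (P.faceCycle s a).sum D.step = 1 := by
  rw [D.sum_step hM, Periodic.isMatching_iff.1 hM, add_sub_cancel_right]

theorem step_nonneg (hM : P.IsMatching M) (a : P.tQ.A) : 0 ≤ D.step a := by
  have h := (D.v_shortest (P.tQ.tgt a)).sum_indicator_le hM
    ((D.v (P.tQ.src a)).comp (Path.single a))
  rw [Path.sum_comp, Path.sum_single] at h
  rw [D.step_eq hM]
  omega

theorem step_eq_zero (hM : P.IsMatching M) {a : P.tQ.A} {w : Path P.tQ i0 (P.tQ.src a)}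
    (hw : P.Shortest w) (hwa : P.Shortest (w.comp (Path.single a))) : D.step a = 0 := by
  have h₁ := hw.sum_indicator_le hM (D.v _)
  have h₂ := (D.v_shortest _).sum_indicator_le hM w
  have h₃ := hwa.sum_indicator_le hM (D.v _)
  have h₄ := (D.v_shortest _).sum_indicator_le hM (w.comp (Path.single a))
  rw [Path.sum_comp, Path.sum_single] at h₃ h₄
  rw [D.step_eq hM]
  omega

theorem cl_el_comp (hM : P.IsMatching M) {i j : P.tQ.V} (k : ℤ) (w : Path P.tQ i j) :
    D.cl ((D.el i k).comp w.toWeak) = k + w.sum D.step := by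
  have h := D.sum_eq_cl (Periodic.isMatching_iff.1 hM) ((D.el i k).comp w.toWeak)
  rw [el, WPath.sum_comp, WPath.sum_comp, WPath.sum_zpow, Path.sum_toWeak, Path.sum_toWeak,
    Path.sum_toWeak, D.sum_omega (Periodic.isMatching_iff.1 hM), smul_eq_mul, smul_eq_mul,
    mul_one, mul_one] at h
  rw [D.sum_step hM, el]
  omega

theorem le_iff (hM : P.IsMatching M) {i j : P.tQ.V} {k l : ℤ} :
    D.le (i, k) (j, l) ↔ ∃ w : Path P.tQ i j, k + w.sum D.step = l := by
  simp only [le, D.cl_el_comp hM]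

theorem le_single (hM : P.IsMatching M) (a : P.tQ.A) (k : ℤ) :
    D.le (P.tQ.src a, k) (P.tQ.tgt a, k + D.step a) :=
  (D.le_iff hM).2 ⟨Path.single a, by rw [Path.sum_single]⟩

theorem le_of_le (hM : P.IsMatching M) (hc : P.Consistent2) (i : P.tQ.V) {k l : ℤ}
    (h : k ≤ l) : D.le (i, k) (i, l) := by
  obtain ⟨a, rfl, -⟩ := (hc i0 i (D.v i) (D.v_shortest i)).1
  have hw : ∀ n : ℕ, ∃ w : Path P.tQ (P.tQ.src a) (P.tQ.src a), w.sum D.step = n := by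
    intro n
    induction n with
    | zero => exact ⟨.nil _, rfl⟩
    | succ n ih =>
      obtain ⟨w, hw⟩ := ih
      exact ⟨w.comp (P.faceCycle true a),
        by rw [Path.sum_comp, hw, D.sum_step_faceCycle hM, Nat.cast_succ]⟩
  obtain ⟨w, hw⟩ := hw (l - k).toNat
  exact (D.le_iff hM).2 ⟨w, by omega⟩

variable {Ω : Finset (P.tQ.V × ℕ)} {H : P.tQ.V → ℤ}

theorem memOm'_iff (hH : ∀ i (k : ℕ), (i, k) ∈ Ω ↔ k < H i) (hH0 : ∀ i, 0 ≤ H i)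
    (i : P.tQ.V) (k : ℤ) : D.memOm' Ω (i, k) ↔ k < H i := by
  have := hH0 i
  simp only [memOm', hH]
  omega

theorem mem_matchOf_iff (hM : P.IsMatching M) (hH : ∀ i (k : ℕ), (i, k) ∈ Ω ↔ k < H i)
    (hH0 : ∀ i, 0 ≤ H i) (a : P.tQ.A) :
    a ∈ D.matchOf Ω ↔ 1 ≤ D.step a + H (P.tQ.src a) - H (P.tQ.tgt a) := by
  simp only [matchOf, Set.mem_ofPred_eq, D.memOm'_iff hH hH0, D.cl_el_comp hM, Path.sum_single]
  constructor
  · rintro ⟨k, h₁, h₂⟩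
    omega
  · intro h
    exact ⟨H (P.tQ.src a) - 1, by omega, by omega⟩

theorem isIdeal_of_height (hM : P.IsMatching M) (hH : ∀ i (k : ℕ), (i, k) ∈ Ω ↔ k < H i)
    (hstep : ∀ a, 0 ≤ D.step a + H (P.tQ.src a) - H (P.tQ.tgt a)) : D.IsIdeal Ω := by
  rintro ⟨j, l⟩ hy i k hle
  obtain ⟨w, hw⟩ : ∃ w : Path P.tQ i j, (k : ℤ) + w.sum D.step = l := (D.le_iff hM).1 hle
  have hsum := Path.sum_add_sub D.step H w
  have hnn : 0 ≤ w.sum fun a => D.step a + H (P.tQ.src a) - H (P.tQ.tgt a) :=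
    List.sum_nonneg (by simpa using fun a _ => hstep a)
  rw [hH] at hy ⊢
  omega

theorem IsIdeal.exists_height {D : DeltaData B P i0} (hΩ : D.IsIdeal Ω) (hM : P.IsMatching M)
    (hc : P.Consistent2) :
    ∃ H : P.tQ.V → ℤ, (∀ i (k : ℕ), (i, k) ∈ Ω ↔ k < H i) ∧ (∀ i, 0 ≤ H i) ∧
      ∀ a, D.step a + H (P.tQ.src a) - H (P.tQ.tgt a) = P.indicator (D.matchOf Ω) a := by
  let N : P.tQ.V → ℕ := fun i => Ω.sup fun x => if x.1 = i then x.2 + 1 else 0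
  have hN : ∀ i k, (i, k) ∈ Ω ↔ k < N i := by
    intro i k
    simp only [N, Finset.lt_sup_iff]
    constructor
    · intro h
      exact ⟨(i, k), h, by simp⟩
    · rintro ⟨⟨j, l⟩, hx, hk⟩
      dsimp only at hk
      split_ifs at hk with h
      · subst h
        exact hΩ _ hx _ _ (D.le_of_le hM hc j (by dsimp only; omega))
      · omega
  have hH : ∀ i (k : ℕ), (i, k) ∈ Ω ↔ (k : ℤ) < (N i : ℤ) := by simpa using hN
  refine ⟨fun i => N i, hH, fun i => by simp, fun a => ?_⟩
  have hg : ∀ a, 0 ≤ D.step a + (N (P.tQ.src a) : ℤ) - N (P.tQ.tgt a) := by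
    intro a
    have ha := D.step_nonneg hM a
    by_contra! hlt
    have h := hΩ (P.tQ.tgt a, N (P.tQ.tgt a) - 1) ((hN _ _).2 (by omega)) (P.tQ.src a)
      (N (P.tQ.tgt a) - 1 - D.step a).toNat
      (by convert D.le_single hM a _ using 2; dsimp only; omega)
    rw [hN] at h
    omega
  have h := Periodic.indicator_setOf_one_le hg fun s a => by
    rw [Path.sum_add_sub _ fun i => (N i : ℤ), D.sum_step_faceCycle hM, add_sub_cancel_right]
  refine (congrFun h a).symm.trans ?_
  congr 1
  ext a
  exact (D.mem_matchOf_iff hM hH (fun i => by simp) a).symm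

end DeltaData
/-! ### Ideals and perfect matchings -/

namespace DeltaData

variable {B : BraneTiling} {P : Periodic B} {i0 : P.tQ.V} {I M : Set P.tQ.A}

theorem infinite_vertices (D : DeltaData B P i0) (hB : B.NonDegenerate) (hc : P.Consistent2) :
    Infinite P.tQ.V :=
  Set.infinite_univ_iff.1 <| Periodic.infinite_of_shortest_extension hB hc (D.v_shortest i0)
    (Set.mem_univ _) fun _ _ _ _ _ => Set.mem_univ _

variable {D : DeltaData B P i0}

theorem indicator_matchOf_empty (hM : P.IsMatching M) :
    P.indicator (D.matchOf (∅ : Finset (P.tQ.V × ℕ))) = D.step := by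
  rw [← Periodic.indicator_setOf_one_le (D.step_nonneg hM) (D.sum_step_faceCycle hM)]
  congr 1
  ext a
  rw [D.mem_matchOf_iff hM (H := fun _ => 0) (by simp) (by simp)]
  simp

theorem isMatching_matchOf_empty (hM : P.IsMatching M) :
    P.IsMatching (D.matchOf (∅ : Finset (P.tQ.V × ℕ))) := by
  rw [Periodic.isMatching_iff, indicator_matchOf_empty hM]
  exact D.sum_step_faceCycle hM

theorem height_nonneg (hB : B.NonDegenerate) (hc : P.Consistent2) (hM : P.IsMatching M)
    {H : P.tQ.V →₀ ℤ} (hH : ∀ a, 0 ≤ D.step a + H (P.tQ.src a) - H (P.tQ.tgt a))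
    (i : P.tQ.V) : 0 ≤ H i := by
  by_contra! hi
  refine Periodic.infinite_of_shortest_extension hB hc (D.v_shortest i) (K := {i | H i < 0}) hi
    (fun a w hw hwa ha => ?_) (H.support.finite_toSet.subset fun j hj => ?_)
  · have h := hH a
    rw [D.step_eq_zero hM hw hwa] at h
    simp only [Set.mem_ofPred_eq] at ha ⊢
    omega
  · exact Finsupp.mem_support_iff.2 (ne_of_lt hj)

theorem exists_isIdeal (hB : B.NonDegenerate) (hc1 : B.Consistent1) (hc2 : P.Consistent2)
    (hI : P.IsMatching I)
    (hfin : (symmDiff I (D.matchOf (∅ : Finset (P.tQ.V × ℕ)))).Finite) :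
    ∃ Ω : Finset (P.tQ.V × ℕ), D.IsIdeal Ω ∧ D.matchOf Ω = I := by
  obtain ⟨H, hH⟩ := D.exists_finsupp_sub_eq hB hc1 hI (isMatching_matchOf_empty hI) hfin
  rw [indicator_matchOf_empty hI] at hH
  have hstep : ∀ a, D.step a + H (P.tQ.src a) - H (P.tQ.tgt a) = P.indicator I a := by
    intro a
    have := hH a
    omega
  have hnn : ∀ a, 0 ≤ D.step a + H (P.tQ.src a) - H (P.tQ.tgt a) := by
    intro a
    rw [hstep, Periodic.indicator]
    split_ifs <;> decide
  have hH0 := height_nonneg hB hc2 hI hnn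
  let Ω := H.support.biUnion fun i => (Finset.range (H i).toNat).image (Prod.mk i)
  have hΩ : ∀ i (k : ℕ), (i, k) ∈ Ω ↔ k < H i := by
    intro i k
    have := hH0 i
    simp only [Ω, Finset.mem_biUnion, Finset.mem_image, Finset.mem_range, Prod.mk.injEq,
      Finsupp.mem_support_iff]
    constructor
    · rintro ⟨j, -, l, hl, rfl, rfl⟩
      omega
    · exact fun h => ⟨i, by omega, k, by omega, rfl, rfl⟩
  refine ⟨Ω, D.isIdeal_of_height hI hΩ hnn, ?_⟩
  ext a
  rw [D.mem_matchOf_iff hI hΩ hH0, hstep, Periodic.indicator]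
  split_ifs with h <;> simp [h]

theorem IsIdeal.eq_of_matchOf_eq (hB : B.NonDegenerate) (hc : P.Consistent2)
    (hM : P.IsMatching M) {Ω₁ Ω₂ : Finset (P.tQ.V × ℕ)} (h₁ : D.IsIdeal Ω₁)
    (h₂ : D.IsIdeal Ω₂) (h : D.matchOf Ω₁ = D.matchOf Ω₂) : Ω₁ = Ω₂ := by
  obtain ⟨H₁, hH₁, hn₁, hs₁⟩ := h₁.exists_height hM hc
  obtain ⟨H₂, hH₂, hn₂, hs₂⟩ := h₂.exists_height hM hc
  have hconst : ∀ i, H₁ i0 - H₂ i0 = H₁ i - H₂ i := fun i =>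
    (D.v i).apply_eq (F := fun i => H₁ i - H₂ i) fun a _ => by
      have e₁ := hs₁ a
      have e₂ := hs₂ a
      rw [h] at e₁
      omega
  have := D.infinite_vertices hB hc
  obtain ⟨j, hj⟩ := Infinite.exists_notMem_finset ((Ω₁ ∪ Ω₂).image Prod.fst)
  have hz : ∀ k, (j, k) ∉ Ω₁ ∪ Ω₂ := fun k hk => hj (Finset.mem_image_of_mem _ hk)
  have hz := hz 0
  rw [Finset.mem_union, hH₁, hH₂] at hz
  ext ⟨i, k⟩
  rw [hH₁, hH₂]
  have := hconst i
  have := hconst j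
  have := hn₁ j
  have := hn₂ j
  omega

theorem IsIdeal.mem_iff_mem_minOm' (hB : B.NonDegenerate) (hc : P.Consistent2)
    (hI : P.IsMatching I) {Ω : Finset (P.tQ.V × ℕ)} (hΩ : D.IsIdeal Ω)
    (hΩI : D.matchOf Ω = I) (i : P.tQ.V) (k : ℕ) :
    (i, k) ∈ Ω ↔ (i, (k : ℤ)) ∈ D.minOm' I := by
  obtain ⟨H, hH, hn, hs⟩ := hΩ.exists_height hI hc
  rw [hΩI] at hs
  rw [hH]
  constructor
  · rintro hk S ⟨hneg, hle, hmul⟩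
    let T : P.tQ.V → Prop := fun i => (i, H i - 1) ∈ S
    have hT : ∀ a ∉ I, T (P.tQ.src a) = T (P.tQ.tgt a) := by
      intro a ha
      have e := hs a
      rw [Periodic.indicator, if_neg ha] at e
      have e' : H (P.tQ.tgt a) - 1 = H (P.tQ.src a) - 1 + D.step a := by omega
      refine propext ⟨fun h => ?_, fun h => ?_⟩
      · have h' := hmul a ha _ h
        rwa [D.cl_el_comp hI, Path.sum_single, ← e'] at h'
      · exact hle _ h _ (e' ▸ D.le_single hI a _)
    have hT' : ∀ a, T (P.tQ.src a) = T (P.tQ.tgt a) := by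
      intro a
      by_cases ha : a ∈ I
      · exact ((P.twface true a).apply_eq fun b hb => hT b (hI.not_mem_of_mem_twface ha hb)).symm
      · exact hT a ha
    have hconst : ∀ i, T i0 = T i := fun i => (D.v i).apply_eq fun a _ => hT' a
    have := D.infinite_vertices hB hc
    obtain ⟨j, hj⟩ := Infinite.exists_notMem_finset (Ω.image Prod.fst)
    have hz : (j, 0) ∉ Ω := fun h => hj (Finset.mem_image_of_mem _ h)
    rw [hH] at hz
    have hTj : T j := hneg _ _ (by omega)
    have hTi : T i := by rwa [← hconst, hconst j]
    exact hle _ hTi _ (D.le_of_le hI hc i (by omega))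
  · intro h
    refine h {x | x.2 < H x.1} ⟨fun j l hl => hl.trans_le (hn j), ?_, fun a ha l hl => ?_⟩
    · rintro ⟨j, l⟩ hy ⟨m, n⟩ hle
      obtain ⟨w, hw⟩ : ∃ w : Path P.tQ m j, n + w.sum D.step = l := (D.le_iff hI).1 hle
      have hsum := Path.sum_add_sub D.step H w
      have hnn : 0 ≤ w.sum fun a => D.step a + H (P.tQ.src a) - H (P.tQ.tgt a) := by
        refine List.sum_nonneg (List.forall_mem_map.2 fun a _ => ?_)
        rw [hs, Periodic.indicator]
        split_ifs <;> decide
      simp only [Set.mem_ofPred_eq] at hy ⊢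
      omega
    · have e := hs a
      rw [Periodic.indicator, if_neg ha] at e
      simp only [Set.mem_ofPred_eq] at hl ⊢
      rw [D.cl_el_comp hI, Path.sum_single]
      omega

end DeltaData

/-- Let `(Q, W)` arise from a non-degenerate brane tiling
satisfying both consistency conditions, fix `i₀ ∈ Q̃₀`, and let `I₀ = I(∅)` be
the canonical perfect matching.  Then for any perfect matching `I` of the
plane tiling defined by `Q̃` which is congruent to `I₀` (i.e. the symmetric
difference of `I` and `I₀` is finite), there exists a unique finite ideal `Ω`
of `Δ` such that `I(Ω) = I`; this ideal equals `Ω′ ∩ Δ`, where `Ω′` is the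
minimal ideal in `Δ′` containing `Q̃₀ × ℤ_{<0}` and such that for every arrow
`a ∉ I` and every `u ∈ Ω′_{s(a)}` one has `au ∈ Ω′_{t(a)}`. -/
theorem matching_unique_ideal (B : BraneTiling) (hB : B.NonDegenerate)
    (hc1 : B.Consistent1) (P : Periodic B) (hc2 : P.Consistent2)
    (i0 : P.tQ.V) (D : DeltaData B P i0)
    (I : Set P.tQ.A) (hI : P.IsMatching I)
    (hcong : (symmDiff I (D.matchOf (∅ : Finset (P.tQ.V × ℕ)))).Finite) :
    (∃! Ω : Finset (P.tQ.V × ℕ), D.IsIdeal Ω ∧ D.matchOf Ω = I) ∧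
    (∀ Ω : Finset (P.tQ.V × ℕ), D.IsIdeal Ω → D.matchOf Ω = I →
      ∀ (i : P.tQ.V) (k : ℕ), ((i, k) ∈ Ω ↔ (i, (k : ℤ)) ∈ D.minOm' I)) := by
  obtain ⟨Ω, hΩ, hΩI⟩ := DeltaData.exists_isIdeal hB hc1 hc2 hI hcong
  exact ⟨⟨Ω, ⟨hΩ, hΩI⟩, fun Ω' h => h.1.eq_of_matchOf_eq hB hc2 hI hΩ (h.2.trans hΩI.symm)⟩,
    fun Ω' h₁ h₂ => h₁.mem_iff_mem_minOm' hB hc2 hI h₂⟩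
end
end
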